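/- arXiv:1409.0515 — 9 statements merged into one kernel-verified Lean document; each statement's English description precedes it below -/
import Mathlib

section
/- Existence of an optimal transport map for a convex cost (Monge problem). Let d ≥ 1 and let c : ℝ^d → ℝ be convex, nonnegative, and of superlinear growth. Let μ and ν be Borel probability measures on ℝ^d with compact support such that μ is absolutely continuous with respect to the Lebesgue measure. Then there exists a Borel map T : ℝ^d → ℝ^d such that the pushforward of μ under T equals ν, and for every transference plan π ∈ Π(μ,ν) one has ∫ c(T(x) − x) dμ(x) ≤ ∫ c(x' − x) dπ(x,x'); in particular the pushforward of μ under x ↦ (x, T(x)) is an optimal transference plan. -/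
open MeasureTheory

/-- The set of transference plans (couplings) between two Borel probability measures:
probability measures on the product whose marginals are `μ` and `ν`. -/
def Coupling {X : Type*} [MeasurableSpace X] (μ ν : Measure X) : Set (Measure (X × X)) :=
  {π | IsProbabilityMeasure π ∧ π.map Prod.fst = μ ∧ π.map Prod.snd = ν}

section OptimalPlans

open scoped ENNReal NNReal ProbabilityTheory
open BoundedContinuousFunction

/-- If the images of two measures under `f` are not mutually singular, then nonzero parts of the two
measures can be coupled along the fibres of `f`. -/
theorem exists_gluing_of_not_mutuallySingular {Ω Z : Type*} [MeasurableSpace Ω]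
    [StandardBorelSpace Ω] [Nonempty Ω] [MeasurableSpace Z] [StandardBorelSpace Z]
    {f : Ω → Z} (hf : Measurable f) (μ₁ μ₂ : Measure Ω) [IsFiniteMeasure μ₁] [IsFiniteMeasure μ₂]
    (h : ¬ μ₁.map f ⟂ₘ μ₂.map f) :
    ∃ Θ : Measure (Ω × Ω), IsFiniteMeasure Θ ∧ Θ ≠ 0 ∧ Θ.map Prod.fst ≤ μ₁ ∧
      Θ.map Prod.snd ≤ μ₂ ∧ ∀ᵐ w ∂Θ, f w.1 = f w.2 := by
  obtain ⟨σ, hσ₁, hσ₂, hσ⟩ : ∃ σ : Measure Z, σ ≤ μ₁.map f ∧ σ ≤ μ₂.map f ∧ σ ≠ 0 := by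
    rw [Measure.mutuallySingular_iff_disjoint, Disjoint] at h
    push Not at h
    obtain ⟨σ, h₁, h₂, h₃⟩ := h
    exact ⟨σ, h₁, h₂, fun h => h₃ h.le⟩
  have : IsFiniteMeasure σ := isFiniteMeasure_of_le _ hσ₁
  have key : ∀ (m : Measure Ω) [IsFiniteMeasure m], σ ≤ m.map f →
      ∃ κ : ProbabilityTheory.Kernel Z Ω, ProbabilityTheory.IsMarkovKernel κ ∧
        σ.bind κ ≤ m ∧ ∀ᵐ z ∂σ, ∀ᵐ e ∂(κ z), f e = z := by
    intro m _ hm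
    set ρ : Measure (Z × Ω) := m.map (fun e => (f e, e)) with hρ
    have hmeas : Measurable (fun e => (f e, e)) := hf.prodMk measurable_id
    have hfst : ρ.fst = m.map f := by
      rw [hρ, Measure.fst, Measure.map_map measurable_fst hmeas]; rfl
    have hsnd : ρ.snd = m := by
      rw [hρ, Measure.snd, Measure.map_map measurable_snd hmeas]
      exact Measure.map_id
    have hdis : ρ.fst ⊗ₘ ρ.condKernel = ρ := ρ.disintegrate ρ.condKernel
    refine ⟨ρ.condKernel, inferInstance, ?_, ?_⟩
    · calc σ.bind ρ.condKernel ≤ ρ.fst.bind ρ.condKernel := by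
            refine Measure.le_iff.2 fun s hs => ?_
            rw [Measure.bind_apply hs (ProbabilityTheory.Kernel.aemeasurable _),
              Measure.bind_apply hs (ProbabilityTheory.Kernel.aemeasurable _), hfst]
            exact lintegral_mono' hm le_rfl
        _ = m := by rw [← Measure.snd_compProd, hdis, hsnd]
    · have h1 : ∀ᵐ p ∂(ρ.fst ⊗ₘ ρ.condKernel), f p.2 = p.1 := by
        have hE : MeasurableSet {p : Z × Ω | f p.2 = p.1} :=
          measurableSet_eq_fun (hf.comp measurable_snd) measurable_fst
        rw [hdis, hρ]
        exact (ae_map_iff hmeas.aemeasurable hE).2 (by simp)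
      have h2 := Measure.ae_ae_of_ae_compProd h1
      rw [hfst] at h2
      exact ae_mono hm h2
  obtain ⟨κ₁, _, h₁, h₁'⟩ := key μ₁ hσ₁
  obtain ⟨κ₂, _, h₂, h₂'⟩ := key μ₂ hσ₂
  refine ⟨σ.bind (κ₁ ×ₖ κ₂), ?_, ?_, ?_, ?_, ?_⟩
  · infer_instance
  · intro h0
    apply hσ
    rw [← Measure.measure_univ_eq_zero] at h0 ⊢
    rw [Measure.bind_apply .univ (ProbabilityTheory.Kernel.aemeasurable _)] at h0
    simpa using h0
  · refine le_trans (le_of_eq ?_) h₁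
    ext s hs
    rw [Measure.map_apply measurable_fst hs, Measure.bind_apply (measurable_fst hs)
      (ProbabilityTheory.Kernel.aemeasurable _), Measure.bind_apply hs
      (ProbabilityTheory.Kernel.aemeasurable _)]
    refine lintegral_congr fun z => ?_
    rw [ProbabilityTheory.Kernel.prod_apply, ← Set.prod_univ, Measure.prod_prod]
    simp
  · refine le_trans (le_of_eq ?_) h₂
    ext s hs
    rw [Measure.map_apply measurable_snd hs, Measure.bind_apply (measurable_snd hs)
      (ProbabilityTheory.Kernel.aemeasurable _), Measure.bind_apply hs
      (ProbabilityTheory.Kernel.aemeasurable _)]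
    refine lintegral_congr fun z => ?_
    rw [ProbabilityTheory.Kernel.prod_apply, ← Set.univ_prod, Measure.prod_prod]
    simp
  · have hm : MeasurableSet {w : Ω × Ω | f w.1 = f w.2} :=
      measurableSet_eq_fun (hf.comp measurable_fst) (hf.comp measurable_snd)
    rw [ae_iff]
    change (σ.bind (κ₁ ×ₖ κ₂)) ({w : Ω × Ω | f w.1 = f w.2}ᶜ) = 0
    rw [Measure.bind_apply hm.compl (ProbabilityTheory.Kernel.aemeasurable _),
      lintegral_eq_zero_iff (ProbabilityTheory.Kernel.measurable_coe _ hm.compl)]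
    filter_upwards [h₁', h₂'] with z hz₁ hz₂
    rw [ProbabilityTheory.Kernel.prod_apply]
    change ((κ₁ z).prod (κ₂ z)) ({w : Ω × Ω | f w.1 = f w.2}ᶜ) = 0
    have e₁ : ∀ᵐ w ∂((κ₁ z).prod (κ₂ z)), f w.1 = z :=
      Measure.quasiMeasurePreserving_fst.ae hz₁
    have e₂ : ∀ᵐ w ∂((κ₁ z).prod (κ₂ z)), f w.2 = z :=
      Measure.quasiMeasurePreserving_snd.ae hz₂
    have := e₁.and e₂
    rw [← mem_ae_iff]
    filter_upwards [this] with w hw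
    exact hw.1.trans hw.2.symm

section Interpolation

variable {E : Type*} [NormedAddCommGroup E] [InnerProductSpace ℝ E]

/-- The point dividing the segment from `p.1` to `p.2` in the ratio `t : 1 - t`. -/
def interp (t : ℝ) (p : E × E) : E := (1 - t) • p.1 + t • p.2

theorem continuous_interp (t : ℝ) : Continuous (interp t : E × E → E) := by
  unfold interp; fun_prop

end Interpolation

section Exchange

variable {E : Type*} [NormedAddCommGroup E] [MeasurableSpace E]

/-- Minimality among plans with the same marginals, first for `c` and then for `q`. -/
def LexMin (c q : E × E →ᵇ ℝ) (γ : Measure (E × E)) : Prop :=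
  ∀ γ' : Measure (E × E), IsFiniteMeasure γ' → γ'.map Prod.fst = γ.map Prod.fst →
    γ'.map Prod.snd = γ.map Prod.snd →
    ∫ p, c p ∂γ ≤ ∫ p, c p ∂γ' ∧
      (∫ p, c p ∂γ' ≤ ∫ p, c p ∂γ → ∫ p, q p ∂γ ≤ ∫ p, q p ∂γ')

theorem LexMin.smul {c q : E × E →ᵇ ℝ} {γ : Measure (E × E)} [IsFiniteMeasure γ]
    (h : LexMin c q γ) {a : ℝ≥0} (ha : a ≠ 0) : LexMin c q (a • γ) := by
  intro γ' _ hfst hsnd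
  have key : ∀ {f : E × E → E}, γ'.map f = (a • γ).map f →
      (a⁻¹ • γ').map f = γ.map f := by
    intro f hf
    rw [Measure.map_smul, hf, Measure.map_smul, smul_smul, inv_mul_cancel₀ ha, one_smul]
  have := h (a⁻¹ • γ') inferInstance (key hfst) (key hsnd)
  have hi (F : E × E →ᵇ ℝ) (b : ℝ≥0) (m : Measure (E × E)) :
      ∫ p, F p ∂(b • m) = (b : ℝ) * ∫ p, F p ∂m := by
    rw [integral_smul_nnreal_measure]; rfl
  simp only [hi] at this ⊢
  have ha' : (0 : ℝ) < a := by positivity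
  push_cast at this
  simp only [inv_mul_le_iff₀ ha', le_inv_mul_iff₀ ha'] at this
  exact this

variable [BorelSpace E] [SecondCountableTopology E]

theorem LexMin.mono {c q : E × E →ᵇ ℝ} {γ γ₁ : Measure (E × E)} [IsFiniteMeasure γ]
    (h : LexMin c q γ) (hle : γ₁ ≤ γ) : LexMin c q γ₁ := by
  intro γ' _ hfst hsnd
  have : IsFiniteMeasure γ₁ := isFiniteMeasure_of_le _ hle
  have hadd := Measure.sub_add_cancel_of_le hle
  have hi (F : E × E →ᵇ ℝ) (m : Measure (E × E)) [IsFiniteMeasure m] :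
      ∫ p, F p ∂((γ - γ₁) + m) = ∫ p, F p ∂(γ - γ₁) + ∫ p, F p ∂m :=
    integral_add_measure (F.integrable _) (F.integrable _)
  have := h ((γ - γ₁) + γ') inferInstance
    (by rw [Measure.map_add _ _ measurable_fst, hfst, ← Measure.map_add _ _ measurable_fst, hadd])
    (by rw [Measure.map_add _ _ measurable_snd, hsnd, ← Measure.map_add _ _ measurable_snd, hadd])
  rw [← hadd] at this
  simp only [hadd, hi] at this
  rw [← hadd] at this
  simp only [hi] at this
  grind

variable [InnerProductSpace ℝ E]

/-- Exchanging the endpoints of two segments of `K` which meet at time `t` does not increase `c`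
and strictly decreases `q`. -/
def SwapDecreasing (c q : E × E →ᵇ ℝ) (t : ℝ) (K : Set E) : Prop :=
  ∀ x ∈ K, ∀ y ∈ K, ∀ x' ∈ K, ∀ y' ∈ K, interp t (x, y) = interp t (x', y') → y ≠ y' →
    c (x, y') + c (x', y) ≤ c (x, y) + c (x', y') ∧
    q (x, y') + q (x', y) < q (x, y) + q (x', y')

/-- For a lexicographic minimizer, the interpolants of the mass sent to `B` and of the mass sent to
`Bᶜ` are mutually singular: exchanging the endpoints of segments that meet would be profitable. -/
theorem LexMin.mutuallySingular [CompleteSpace E] {c q : E × E →ᵇ ℝ} {t : ℝ} {K : Set E}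
    {γ : Measure (E × E)} [IsFiniteMeasure γ] (h : LexMin c q γ) (hswap : SwapDecreasing c q t K)
    (hK : ∀ᵐ p ∂γ, p.1 ∈ K ∧ p.2 ∈ K) {B : Set E} (hB : MeasurableSet B) :
    (γ.restrict (Prod.snd ⁻¹' B)).map (interp t) ⟂ₘ
      (γ.restrict (Prod.snd ⁻¹' B)ᶜ).map (interp t) := by
  by_contra hsing
  have hB' : MeasurableSet (Prod.snd ⁻¹' B : Set (E × E)) := measurable_snd hB
  obtain ⟨Θ, _, hΘ0, hΘ₁, hΘ₂, hΘ⟩ :=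
    exists_gluing_of_not_mutuallySingular (continuous_interp t).measurable _ _ hsing
  have hmem₁ : ∀ᵐ w ∂Θ, (w.1.1 ∈ K ∧ w.1.2 ∈ K) ∧ w.1.2 ∈ B := by
    have := ae_mono hΘ₁ ((ae_restrict_of_ae hK).and (ae_restrict_mem hB'))
    exact ae_of_ae_map measurable_fst.aemeasurable this
  have hmem₂ : ∀ᵐ w ∂Θ, (w.2.1 ∈ K ∧ w.2.2 ∈ K) ∧ w.2.2 ∉ B := by
    have := ae_mono hΘ₂ ((ae_restrict_of_ae hK).and (ae_restrict_mem hB'.compl))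
    exact ae_of_ae_map measurable_snd.aemeasurable this
  set γ₁ := Θ.map Prod.fst + Θ.map Prod.snd with hγ₁
  have hle : γ₁ ≤ γ := by
    calc γ₁ ≤ _ := add_le_add hΘ₁ hΘ₂
      _ = γ := Measure.restrict_add_restrict_compl hB'
  have hγ₁min := h.mono hle
  set s₁ : (E × E) × (E × E) → E × E := fun w => (w.1.1, w.2.2) with hs₁
  set s₂ : (E × E) × (E × E) → E × E := fun w => (w.2.1, w.1.2) with hs₂
  have ms₁ : Measurable s₁ := by fun_prop
  have ms₂ : Measurable s₂ := by fun_prop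
  have hmin := hγ₁min (Θ.map s₁ + Θ.map s₂) inferInstance
    (by
      rw [hγ₁, Measure.map_add _ _ measurable_fst, Measure.map_add _ _ measurable_fst,
        Measure.map_map measurable_fst ms₁, Measure.map_map measurable_fst ms₂,
        Measure.map_map measurable_fst measurable_fst,
        Measure.map_map measurable_fst measurable_snd]
      rfl)
    (by
      rw [hγ₁, Measure.map_add _ _ measurable_snd, Measure.map_add _ _ measurable_snd,
        Measure.map_map measurable_snd ms₁, Measure.map_map measurable_snd ms₂,
        Measure.map_map measurable_snd measurable_fst,
        Measure.map_map measurable_snd measurable_snd,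
        add_comm]
      rfl)
  have hint (F : E × E →ᵇ ℝ) {g : (E × E) × (E × E) → E × E} (hg : Measurable g) :
      Integrable (fun w => F (g w)) Θ :=
    (integrable_map_measure F.continuous.aestronglyMeasurable hg.aemeasurable).1 (F.integrable _)
  have hsum (F : E × E →ᵇ ℝ) {g g' : (E × E) × (E × E) → E × E} (hg : Measurable g)
      (hg' : Measurable g') :
      ∫ p, F p ∂(Θ.map g + Θ.map g') = ∫ w, F (g w) + F (g' w) ∂Θ := by
    rw [integral_add_measure (F.integrable _) (F.integrable _),
      integral_map hg.aemeasurable F.continuous.aestronglyMeasurable,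
      integral_map hg'.aemeasurable F.continuous.aestronglyMeasurable,
      integral_add (hint F hg) (hint F hg')]
  rw [hγ₁] at hmin
  simp only [hsum _ ms₁ ms₂, hsum _ measurable_fst measurable_snd] at hmin
  have hpt : ∀ᵐ w ∂Θ, c (s₁ w) + c (s₂ w) ≤ c w.1 + c w.2 ∧
      q (s₁ w) + q (s₂ w) < q w.1 + q w.2 := by
    filter_upwards [hmem₁, hmem₂, hΘ] with w h₁ h₂ h₃
    exact hswap _ h₁.1.1 _ h₁.1.2 _ h₂.1.1 _ h₂.1.2 h₃ fun heq => h₂.2 (heq ▸ h₁.2)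
  have hc := integral_mono_ae ((hint c ms₁).add (hint c ms₂))
    ((hint c measurable_fst).add (hint c measurable_snd)) (hpt.mono fun w hw => hw.1)
  have hq := hmin.2 hc
  have hI := ((hint q measurable_fst).add (hint q measurable_snd)).sub
    ((hint q ms₁).add (hint q ms₂))
  have hpos : 0 < ∫ w, (q w.1 + q w.2) - (q (s₁ w) + q (s₂ w)) ∂Θ := by
    refine (integral_pos_iff_support_of_nonneg_ae
      (hpt.mono fun w hw => (sub_pos.2 hw.2).le) hI).2 ?_
    rw [pos_iff_ne_zero]
    intro h0
    apply hΘ0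
    rw [← ae_eq_bot, ← Filter.empty_mem_iff_bot]
    have h0' := measure_eq_zero_iff_ae_notMem.1 h0
    filter_upwards [h0', hpt] with w hw hw'
    exact hw (sub_pos.2 hw'.2).ne'
  have hsub := integral_sub ((hint q measurable_fst).add (hint q measurable_snd))
    ((hint q ms₁).add (hint q ms₂))
  simp only [Pi.add_apply] at hsub
  linarith

end Exchange

section Density

theorem add_le_of_mutuallySingular {Ω : Type*} [MeasurableSpace Ω] {μ ν ξ : Measure Ω}
    (hμ : μ ≤ ξ) (hν : ν ≤ ξ) (h : μ ⟂ₘ ν) : μ + ν ≤ ξ := by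
  obtain ⟨s, hs, hμs, hνs⟩ := h
  refine Measure.le_iff.2 fun A hA => ?_
  rw [Measure.add_apply, ← measure_inter_add_sdiff A hs, ← measure_inter_add_sdiff (μ := ν) A hs,
    ← measure_inter_add_sdiff (μ := ξ) A hs, measure_mono_null Set.inter_subset_right hμs,
    measure_mono_null (fun x hx => hx.2 : A \ s ⊆ sᶜ) hνs, zero_add, add_zero, add_comm]
  exact add_le_add (hν _) (hμ _)

variable {E : Type*} [NormedAddCommGroup E] [InnerProductSpace ℝ E] [FiniteDimensional ℝ E]
  [MeasurableSpace E] [BorelSpace E]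

theorem map_interp_le_of_snd_eq {γ : Measure (E × E)} {l : Measure E} [l.IsAddHaarMeasure]
    (hfst : γ.map Prod.fst ≤ l) {t : ℝ} (ht : t < 1) {a : E} (ha : ∀ᵐ p ∂γ, p.2 = a) :
    γ.map (interp t) ≤ ENNReal.ofReal (((1 - t) ^ Module.finrank ℝ E)⁻¹) • l := by
  refine Measure.le_iff.2 fun A hA => ?_
  have hT : Measurable fun x : E => (1 - t) • x + t • a := by fun_prop
  rw [Measure.map_apply (continuous_interp t).measurable hA]
  calc γ (interp t ⁻¹' A) ≤ γ (Prod.fst ⁻¹' ((fun x : E => (1 - t) • x + t • a) ⁻¹' A)) := by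
        refine measure_mono_ae ?_
        filter_upwards [ha] with p hp hpA
        change (1 - t) • p.1 + t • a ∈ A
        rw [← hp]
        exact hpA
    _ = γ.map Prod.fst ((fun x : E => (1 - t) • x + t • a) ⁻¹' A) := by
        rw [Measure.map_apply measurable_fst (hT hA)]
    _ ≤ l ((fun x : E => (1 - t) • x + t • a) ⁻¹' A) := hfst _
    _ = l ((fun x : E => (1 - t) • x) ⁻¹' ((fun x => x + t • a) ⁻¹' A)) := rfl
    _ = _ := by
        rw [Measure.addHaar_preimage_smul _ (by linarith), measure_preimage_add_right,
          Measure.smul_apply, smul_eq_mul, abs_of_nonneg]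
        have : 0 < 1 - t := by linarith
        positivity

theorem LexMin.map_interp_le_of_finite {c q : E × E →ᵇ ℝ} {t : ℝ} {K : Set E}
    {γ : Measure (E × E)} [IsFiniteMeasure γ] (h : LexMin c q γ) (hswap : SwapDecreasing c q t K)
    (hK : ∀ᵐ p ∂γ, p.1 ∈ K ∧ p.2 ∈ K) {l : Measure E} [l.IsAddHaarMeasure]
    (hfst : γ.map Prod.fst ≤ l) (ht : t < 1) (Y : Finset E) (hY : ∀ᵐ p ∂γ, p.2 ∈ Y) :
    γ.map (interp t) ≤ ENNReal.ofReal (((1 - t) ^ Module.finrank ℝ E)⁻¹) • l := by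
  classical
  have := FiniteDimensional.complete ℝ E
  have key : ∀ s : Finset E, (γ.restrict (Prod.snd ⁻¹' (s : Set E))).map (interp t) ≤
      ENNReal.ofReal (((1 - t) ^ Module.finrank ℝ E)⁻¹) • l := by
    intro s
    induction s using Finset.induction_on with
    | empty => simp [Measure.zero_le]
    | insert a s has ih =>
      have hdisj : Disjoint (Prod.snd ⁻¹' {a} : Set (E × E)) (Prod.snd ⁻¹' (s : Set E)) := by
        refine Disjoint.preimage _ ?_
        simpa using has
      have hms : MeasurableSet (Prod.snd ⁻¹' (s : Set E) : Set (E × E)) :=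
        measurable_snd s.measurableSet
      rw [Finset.coe_insert, Set.insert_eq, Set.preimage_union, Measure.restrict_union hdisj hms,
        Measure.map_add _ _ (continuous_interp t).measurable]
      refine add_le_of_mutuallySingular ?_ ih ?_
      · refine map_interp_le_of_snd_eq
          ((Measure.map_mono Measure.restrict_le_self measurable_fst).trans hfst) ht (a := a) ?_
        exact ae_restrict_mem (measurable_snd (measurableSet_singleton a))
      · refine (h.mutuallySingular hswap hK (measurableSet_singleton a)).mono le_rfl
          (Measure.map_mono (Measure.restrict_mono ?_ le_rfl) (continuous_interp t).measurable)
        intro p hp hpa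
        exact hdisj.le_bot ⟨hpa, hp⟩
  have := key Y
  have hY' : ∀ᵐ p ∂γ, p ∈ Prod.snd ⁻¹' (Y : Set E) := hY
  rwa [Measure.restrict_eq_self_of_ae_mem hY'] at this

end Density

section Semiconvexity

variable {E : Type*} [NormedAddCommGroup E] [InnerProductSpace ℝ E]

/-- A function with second differences bounded below by `-2 * N * ‖h‖ ^ 2`. -/
def Semiconvex (N : ℝ) (f : E → ℝ) : Prop :=
  ∀ z h, 2 * f z - 2 * N * ‖h‖ ^ 2 ≤ f (z + h) + f (z - h)

theorem semiconvex_max_zero_sub_infDist_sq {F : Set E} (hF : IsCompact F) (hne : F.Nonempty)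
    {N : ℝ} (hN : 0 ≤ N) :
    Semiconvex N fun z => max 0 (1 - N * Metric.infDist z F ^ 2) := by
  intro z h
  obtain ⟨a, ha, hza⟩ := hF.exists_infDist_eq_dist hne z
  have hle : ∀ w : E, 1 - N * ‖w - a‖ ^ 2 ≤ max 0 (1 - N * Metric.infDist w F ^ 2) := by
    intro w
    refine le_trans ?_ (le_max_right _ _)
    have h1 : Metric.infDist w F ≤ ‖w - a‖ := by
      rw [← dist_eq_norm]; exact Metric.infDist_le_dist_of_mem ha
    have h2 : Metric.infDist w F ^ 2 ≤ ‖w - a‖ ^ 2 :=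
      pow_le_pow_left₀ Metric.infDist_nonneg h1 2
    nlinarith
  have hpl := parallelogram_law_with_norm ℝ (z - a) h
  have h1 := hle (z + h)
  have h2 := hle (z - h)
  rw [show z + h - a = z - a + h by abel] at h1
  rw [show z - h - a = z - a - h by abel] at h2
  have h3 : 0 ≤ max 0 (1 - N * Metric.infDist (z + h) F ^ 2) := le_max_left _ _
  have h4 : 0 ≤ max 0 (1 - N * Metric.infDist (z - h) F ^ 2) := le_max_left _ _
  have h5 : 0 ≤ N * ‖h‖ ^ 2 := by positivity
  rcases max_cases 0 (1 - N * Metric.infDist z F ^ 2) with ⟨h6, -⟩ | ⟨h6, -⟩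
  · simp only [h6]; linarith
  · beta_reduce
    rw [h6, hza, dist_eq_norm]
    have : N * (‖z - a + h‖ ^ 2 + ‖z - a - h‖ ^ 2) = N * (2 * (‖z - a‖ ^ 2 + ‖h‖ ^ 2)) := by
      rw [hpl]
    linarith

theorem swapDecreasing_of_convexOn {f : E → ℝ} (hf : ConvexOn ℝ Set.univ f) {c q : E × E →ᵇ ℝ}
    {K : Set E} (hc : ∀ x ∈ K, ∀ y ∈ K, c (x, y) = f (y - x))
    (hq : ∀ x ∈ K, ∀ y ∈ K, q (x, y) = ‖y - x‖ ^ 2) {t : ℝ} (ht : t ∈ Set.Ioo 0 1)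
    {N : ℝ} (hN : 0 < N) (χ : E →ᵇ ℝ) (hχ : Semiconvex N χ) :
    SwapDecreasing c (q - N⁻¹ • χ.compContinuous ⟨interp t, continuous_interp t⟩) t K := by
  intro x hx y hy x' hx' y' hy' hcross hne
  obtain ⟨ht0, ht1⟩ := ht
  unfold interp at hcross
  simp only at hcross
  have h1t : 0 < 1 - t := by linarith
  set D := y' - y with hD
  have hD0 : 0 < ‖D‖ := norm_pos_iff.2 (sub_ne_zero.2 hne.symm)
  have hxx : x = x' + (t / (1 - t)) • D := by
    have : (1 - t) • (x - x') = t • D := by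
      rw [hD, smul_sub, smul_sub, sub_eq_sub_iff_add_eq_add, hcross, add_comm]
    rw [div_eq_inv_mul, mul_smul, ← this, smul_smul, inv_mul_cancel₀ h1t.ne', one_smul]
    abel
  have hyy : y' = y + D := by rw [hD]; abel
  constructor
  · rw [hc x hx y' hy', hc x' hx' y hy, hc x hx y hy, hc x' hx' y' hy']
    have e1 : y' - x = (1 - t) • (y' - x') + t • (y - x) := by
      rw [hyy, hxx]; match_scalars <;> field_simp <;> ring
    have e2 : y - x' = t • (y' - x') + (1 - t) • (y - x) := by
      rw [hyy, hxx]; match_scalars <;> field_simp <;> ring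
    have c1 := hf.2 (Set.mem_univ (y' - x')) (Set.mem_univ (y - x)) h1t.le ht0.le (by ring)
    have c2 := hf.2 (Set.mem_univ (y' - x')) (Set.mem_univ (y - x)) ht0.le h1t.le (by ring)
    rw [← e1] at c1
    rw [← e2] at c2
    simp only [smul_eq_mul] at c1 c2
    linarith
  · simp only [coe_sub, coe_smul, Pi.sub_apply, compContinuous_apply, ContinuousMap.coe_mk,
      smul_eq_mul, hq x hx y' hy', hq x' hx' y hy, hq x hx y hy, hq x' hx' y' hy']
    set z := interp t (x, y) with hz
    have z1 : interp t (x', y') = z := by simp only [hz, interp, hcross]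
    have z2 : interp t (x, y') = z + t • D := by
      simp only [hz, interp, hyy, smul_add]; abel
    have z3 : interp t (x', y) = z - t • D := by
      rw [← z1]; simp only [interp, hyy, smul_add]; abel
    rw [z1, z2, z3]
    have hs := hχ z (t • D)
    rw [norm_smul, Real.norm_of_nonneg ht0.le] at hs
    have hqd : ‖y' - x‖ ^ 2 + ‖y - x'‖ ^ 2 =
        ‖y - x‖ ^ 2 + ‖y' - x'‖ ^ 2 - 2 * (t / (1 - t)) * ‖D‖ ^ 2 := by
      rw [← real_inner_self_eq_norm_sq D, hxx, hyy]
      simp only [← real_inner_self_eq_norm_sq, inner_add_left, inner_add_right, inner_sub_left,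
        inner_sub_right, real_inner_smul_left, real_inner_smul_right]
      rw [real_inner_comm D x', real_inner_comm D y, real_inner_comm y x']
      ring
    have hNs : N⁻¹ * (2 * χ z - 2 * N * (t * ‖D‖) ^ 2) ≤ N⁻¹ * (χ (z + t • D) + χ (z - t • D)) :=
      mul_le_mul_of_nonneg_left hs (by positivity)
    have hNe : N⁻¹ * (2 * χ z - 2 * N * (t * ‖D‖) ^ 2) = 2 * (N⁻¹ * χ z) - 2 * (t * ‖D‖) ^ 2 := by
      field_simp
    have htt : t ^ 2 < t / (1 - t) := by
      rw [lt_div_iff₀ h1t]; nlinarith [mul_pos ht0 ht0]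
    have : t ^ 2 * ‖D‖ ^ 2 < t / (1 - t) * ‖D‖ ^ 2 := by gcongr
    nlinarith

end Semiconvexity

section Plans

theorem FiniteMeasure.continuous_integral {Ω : Type*} [MeasurableSpace Ω] [TopologicalSpace Ω]
    [OpensMeasurableSpace Ω] (F : Ω →ᵇ ℝ) :
    Continuous fun γ : FiniteMeasure Ω => ∫ p, F p ∂(γ : Measure Ω) :=
  continuous_iff_continuousAt.2 fun _ =>
    FiniteMeasure.tendsto_iff_forall_integral_tendsto.1 Filter.tendsto_id F

theorem ae_mem_and_mem_of_marginals {E : Type*} [MeasurableSpace E]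
    {γ₀ γ : Measure (E × E)} {K : Set E} (hK : MeasurableSet K)
    (h₀ : ∀ᵐ p ∂γ₀, p.1 ∈ K ∧ p.2 ∈ K) (hfst : γ.map Prod.fst = γ₀.map Prod.fst)
    (hsnd : γ.map Prod.snd = γ₀.map Prod.snd) : ∀ᵐ p ∂γ, p.1 ∈ K ∧ p.2 ∈ K := by
  have h1 : ∀ᵐ x ∂(γ₀.map Prod.fst), x ∈ K :=
    (ae_map_iff measurable_fst.aemeasurable hK).2 (h₀.mono fun p hp => hp.1)
  have h2 : ∀ᵐ x ∂(γ₀.map Prod.snd), x ∈ K :=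
    (ae_map_iff measurable_snd.aemeasurable hK).2 (h₀.mono fun p hp => hp.2)
  rw [← hfst] at h1
  rw [← hsnd] at h2
  exact (ae_of_ae_map measurable_fst.aemeasurable h1).and
    (ae_of_ae_map measurable_snd.aemeasurable h2)

variable {E : Type*} [NormedAddCommGroup E] [MeasurableSpace E] [BorelSpace E]
  [SecondCountableTopology E]

/-- The finite measures on `E × E` with the same marginals as `γ₀`. -/
def plans (γ₀ : Measure (E × E)) : Set (FiniteMeasure (E × E)) :=
  {γ | (γ : Measure (E × E)).map Prod.fst = γ₀.map Prod.fst ∧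
    (γ : Measure (E × E)).map Prod.snd = γ₀.map Prod.snd}

theorem isCompact_plans {γ₀ : Measure (E × E)} [IsFiniteMeasure γ₀] {K : Set E} (hK : IsCompact K)
    (h₀ : ∀ᵐ p ∂γ₀, p.1 ∈ K ∧ p.2 ∈ K) : IsCompact (plans γ₀) := by
  let γf : FiniteMeasure (E × E) := ⟨γ₀, inferInstance⟩
  have heq : plans γ₀ = {γ : FiniteMeasure (E × E) | γ.map Prod.fst = γf.map Prod.fst} ∩
      {γ | γ.map Prod.snd = γf.map Prod.snd} := by
    ext γ
    simp only [plans, Set.mem_ofPred_eq, Set.mem_inter_iff,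
      ← FiniteMeasure.toMeasure_injective.eq_iff,
      FiniteMeasure.toMeasure_map]
    rfl
  have hclosed : IsClosed (plans γ₀) := by
    rw [heq]
    exact (isClosed_eq (FiniteMeasure.continuous_map continuous_fst) continuous_const).inter
      (isClosed_eq (FiniteMeasure.continuous_map continuous_snd) continuous_const)
  refine (isCompact_setOfPred_finiteMeasure_le_of_isCompact γf.mass (hK.prod hK)).of_isClosed_subset
    hclosed fun γ hγ => ⟨?_, ?_⟩
  · have h := congrArg (fun m => m Set.univ) hγ.1
    simp only [Measure.map_apply measurable_fst MeasurableSet.univ, Set.preimage_univ] at h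
    rw [← ENNReal.coe_le_coe, FiniteMeasure.ennreal_mass, FiniteMeasure.ennreal_mass, h]
    rfl
  · rw [FiniteMeasure.null_iff_toMeasure_null]
    exact ae_mem_and_mem_of_marginals hK.measurableSet h₀ hγ.1 hγ.2

theorem exists_lexMin (c q : E × E →ᵇ ℝ) {γ₀ : Measure (E × E)} [IsFiniteMeasure γ₀] {K : Set E}
    (hK : IsCompact K) (h₀ : ∀ᵐ p ∂γ₀, p.1 ∈ K ∧ p.2 ∈ K) :
    ∃ γ : Measure (E × E), IsFiniteMeasure γ ∧ γ.map Prod.fst = γ₀.map Prod.fst ∧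
      γ.map Prod.snd = γ₀.map Prod.snd ∧ LexMin c q γ := by
  have hcomp := isCompact_plans hK h₀
  obtain ⟨γ₁, hγ₁, hmin₁⟩ := hcomp.exists_isMinOn ⟨⟨γ₀, inferInstance⟩, rfl, rfl⟩
    (FiniteMeasure.continuous_integral c).continuousOn
  have hcomp' : IsCompact (plans γ₀ ∩ {γ | ∫ p, c p ∂(γ : Measure (E × E)) ≤
      ∫ p, c p ∂(γ₁ : Measure (E × E))}) :=
    hcomp.inter_right (isClosed_le (FiniteMeasure.continuous_integral c) continuous_const)
  obtain ⟨γ, hγ, hmin⟩ := hcomp'.exists_isMinOn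
    ⟨γ₁, hγ₁, le_refl (∫ p, c p ∂(γ₁ : Measure (E × E)))⟩
    (FiniteMeasure.continuous_integral q).continuousOn
  refine ⟨γ, inferInstance, hγ.1.1, hγ.1.2, fun γ' hfin hfst hsnd => ?_⟩
  have hmem : (⟨γ', hfin⟩ : FiniteMeasure (E × E)) ∈ plans γ₀ :=
    ⟨hfst.trans hγ.1.1, hsnd.trans hγ.1.2⟩
  have h1 := hmin₁ hmem
  exact ⟨le_trans hγ.2 h1, fun h => hmin ⟨hmem, le_trans h hγ.2⟩⟩

end Plans

section Quantization

theorem IsCompact.exists_measurable_quantizer {E G : Type*} [PseudoMetricSpace E]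
    [MeasurableSpace E] [OpensMeasurableSpace E] [PseudoMetricSpace G] {K : Set E}
    (hK : IsCompact K) (hne : K.Nonempty) {F : E × E → G} (hF : Continuous F) {ε : ℝ} (hε : 0 < ε) :
    ∃ (Q : E → E) (Y : Finset E), Measurable Q ∧ (∀ y, Q y ∈ Y) ∧ (∀ y, Q y ∈ K) ∧
      ∀ x ∈ K, ∀ y ∈ K, dist (F (x, Q y)) (F (x, y)) < ε := by
  obtain ⟨δ, hδ, hF'⟩ := Metric.uniformContinuousOn_iff.1
    ((hK.prod hK).uniformContinuousOn_of_continuous hF.continuousOn) ε hε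
  obtain ⟨y₀, hy₀⟩ := hne
  obtain ⟨s, hsK, hs, hcov⟩ := hK.finite_cover_balls hδ
  lift s to Finset E using hs
  set e : ℕ → E := fun n => s.toList.getD n y₀ with he
  have heK : ∀ n, e n ∈ K := by
    intro n
    by_cases hn : n < s.toList.length
    · rw [he]
      simp only [List.getD_eq_getElem _ _ hn]
      exact hsK (Finset.mem_toList.1 (List.getElem_mem hn))
    · rw [he]
      simp only [List.getD_eq_default _ _ (not_lt.1 hn)]
      exact hy₀
  set Q := SimpleFunc.nearestPt e s.toList.length
  have hQK : ∀ y, Q y ∈ K := by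
    intro y
    simp only [Q, SimpleFunc.nearestPt, SimpleFunc.map_apply]
    exact heK _
  refine ⟨Q, Q.range, Q.measurable, fun y => Q.mem_range_self y, hQK, fun x hx y hy => ?_⟩
  refine hF' _ ⟨hx, hQK y⟩ _ ⟨hx, hy⟩ ?_
  rw [dist_prod_same_left]
  obtain ⟨z, hz, hyz⟩ := Set.mem_iUnion₂.1 (hcov hy)
  obtain ⟨n, hn, rfl⟩ := List.getElem_of_mem (Finset.mem_toList.2 hz)
  have h1 : edist (Q y) y ≤ edist (e n) y := SimpleFunc.edist_nearestPt_le e y hn.le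
  have h2 : e n = s.toList[n] := List.getD_eq_getElem _ _ hn
  rw [edist_dist, edist_dist, ENNReal.ofReal_le_ofReal_iff dist_nonneg] at h1
  refine h1.trans_lt ?_
  rw [h2, dist_comm]
  exact hyz

/-- A plan whose second marginal is the image under `Q` of the second marginal of `γ₀` is itself the
image of a plan with the marginals of `γ₀`. -/
theorem exists_lift_of_map_snd {E : Type*} [MeasurableSpace E] [StandardBorelSpace E] [Nonempty E]
    {γ₀ γ : Measure (E × E)} [IsFiniteMeasure γ₀] [IsFiniteMeasure γ] {Q : E → E}
    (hQ : Measurable Q) (hfst : γ.map Prod.fst = γ₀.map Prod.fst)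
    (hsnd : γ.map Prod.snd = (γ₀.map Prod.snd).map Q) :
    ∃ γ' : Measure (E × E), IsFiniteMeasure γ' ∧ γ'.map Prod.fst = γ₀.map Prod.fst ∧
      γ'.map Prod.snd = γ₀.map Prod.snd ∧ γ'.map (fun p => (p.1, Q p.2)) = γ := by
  set ρ := γ.map Prod.swap with hρ
  set m := γ₀.map Prod.snd with hm
  have hρfst : ρ.fst = m.map Q := by
    rw [hρ, Measure.fst_map_swap, Measure.snd, hsnd]
  have hdis : ρ.fst ⊗ₘ ρ.condKernel = ρ := ρ.disintegrate ρ.condKernel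
  set η := m ⊗ₘ ρ.condKernel.comap Q hQ with hη
  have hmQ : Measurable fun p : E × E => (Q p.1, p.2) := by fun_prop
  have hηQ : η.map (fun p => (Q p.1, p.2)) = ρ := by
    rw [← hdis, hρfst]
    ext s hs
    rw [Measure.map_apply hmQ hs, hη, Measure.compProd_apply (hmQ hs), Measure.compProd_apply hs,
      lintegral_map (ProbabilityTheory.Kernel.measurable_kernel_prodMk_left hs) hQ]
    rfl
  have hmQ' : Measurable fun p : E × E => (p.1, Q p.2) := by fun_prop
  have hlift : (η.map Prod.swap).map (fun p => (p.1, Q p.2)) = γ := by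
    have : (η.map fun p => (Q p.1, p.2)).map Prod.swap = γ := by
      rw [hηQ, hρ, Measure.map_map measurable_swap measurable_swap]
      simp
    rw [← this, Measure.map_map hmQ' measurable_swap, Measure.map_map measurable_swap hmQ]
    rfl
  refine ⟨η.map Prod.swap, inferInstance, ?_, ?_, hlift⟩
  · rw [← hfst, ← hlift, Measure.map_map measurable_fst hmQ']
    rfl
  · change (η.map Prod.swap).snd = m
    rw [Measure.snd_map_swap, hη, Measure.fst_compProd]

end Quantization

section Approximation

variable {E : Type*} [NormedAddCommGroup E] [MeasurableSpace E] [BorelSpace E]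

theorem abs_integral_map_sub_le {γ : Measure (E × E)} [IsFiniteMeasure γ]
    [SecondCountableTopology E] (F : E × E →ᵇ ℝ) {K : Set E} {Q : E → E} (hQ : Measurable Q)
    {ε : ℝ} (hF : ∀ x ∈ K, ∀ y ∈ K, |F (x, Q y) - F (x, y)| ≤ ε)
    (hK : ∀ᵐ p ∂γ, p.1 ∈ K ∧ p.2 ∈ K) :
    |∫ p, F p ∂(γ.map fun p => (p.1, Q p.2)) - ∫ p, F p ∂γ| ≤ ε * γ.real Set.univ := by
  have hm : Measurable fun p : E × E => (p.1, Q p.2) := by fun_prop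
  have hi : Integrable (fun p : E × E => F (p.1, Q p.2)) γ :=
    (integrable_map_measure F.continuous.aestronglyMeasurable hm.aemeasurable).1 (F.integrable _)
  rw [integral_map hm.aemeasurable F.continuous.aestronglyMeasurable,
    ← integral_sub hi (F.integrable _), ← Real.norm_eq_abs]
  exact norm_integral_le_of_norm_le_const (hK.mono fun p hp => hF _ hp.1 _ hp.2)

variable [CompleteSpace E] [SecondCountableTopology E]

theorem LexMin.exists_almost_minimizer {c q : E × E →ᵇ ℝ} {γ₀ : Measure (E × E)}
    [IsFiniteMeasure γ₀] (h : LexMin c q γ₀) {K : Set E} (hK : IsCompact K) (hne : K.Nonempty)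
    (hγ₀ : ∀ᵐ p ∂γ₀, p.1 ∈ K ∧ p.2 ∈ K) (g k : E × E →ᵇ ℝ) {b : ℝ}
    (hb : ∀ s : ℝ, 0 < s → ∀ (γ : Measure (E × E)) [IsFiniteMeasure γ] (Y : Finset E),
      LexMin 0 (c + s • g) γ → γ.map Prod.fst = γ₀.map Prod.fst →
      (∀ᵐ p ∂γ, p.1 ∈ K ∧ p.2 ∈ K) → (∀ᵐ p ∂γ, p.2 ∈ Y) → ∫ p, k p ∂γ ≤ b)
    {η : ℝ} (hη : 0 < η) :
    ∃ γ ∈ plans γ₀, ∫ p, c p ∂(γ : Measure (E × E)) ≤ ∫ p, c p ∂γ₀ + η ∧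
      ∫ p, g p ∂(γ : Measure (E × E)) ≤ ∫ p, g p ∂γ₀ + η ∧
      ∫ p, k p ∂(γ : Measure (E × E)) ≤ b + η := by
  set M := γ₀.real Set.univ with hM
  have hM0 : 0 ≤ M := measureReal_nonneg
  set A := (4 + 2 * ‖g‖) * M with hA
  have hA0 : 0 ≤ A := by positivity
  obtain ⟨s, hs0, hs1, hsA⟩ : ∃ s : ℝ, 0 < s ∧ s ≤ 1 ∧ s * A ≤ η := by
    refine ⟨min 1 (η / (A + 1)), by positivity, min_le_left _ _, ?_⟩
    calc min 1 (η / (A + 1)) * A ≤ η / (A + 1) * (A + 1) :=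
          mul_le_mul (min_le_right _ _) (by linarith) hA0 (by positivity)
      _ = η := by field_simp
  obtain ⟨Q, Y, hQ, hQY, hQK, hdist⟩ := hK.exists_measurable_quantizer hne
    (F := fun p => (c p, g p, k p)) (by fun_prop) (ε := s * s) (by positivity)
  have hosc : ∀ x ∈ K, ∀ y ∈ K, |c (x, Q y) - c (x, y)| ≤ s * s ∧
      |g (x, Q y) - g (x, y)| ≤ s * s ∧ |k (x, Q y) - k (x, y)| ≤ s * s := by
    intro x hx y hy
    have := hdist x hx y hy
    simp only [Prod.dist_eq, Real.dist_eq, max_lt_iff] at this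
    exact ⟨this.1.le, this.2.1.le, this.2.2.le⟩
  have hmQ : Measurable fun p : E × E => (p.1, Q p.2) := by fun_prop
  have hquant : ∀ γ ∈ plans γ₀, ∀ F ∈ ({c, g, k} : Set (E × E →ᵇ ℝ)),
      |∫ p, F p ∂((γ : Measure (E × E)).map fun p => (p.1, Q p.2)) -
        ∫ p, F p ∂(γ : Measure (E × E))| ≤ s * s * M := by
    intro γ hγ F hF
    have hMγ : (γ : Measure (E × E)).real Set.univ = M := by
      have := congrArg (fun m => m.real Set.univ) hγ.1
      simpa only [map_measureReal_apply measurable_fst MeasurableSet.univ, Set.preimage_univ]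
        using this
    rw [← hMγ]
    refine abs_integral_map_sub_le F hQ ?_
      (ae_mem_and_mem_of_marginals hK.measurableSet hγ₀ hγ.1 hγ.2)
    rcases hF with rfl | rfl | rfl
    · exact fun x hx y hy => (hosc x hx y hy).1
    · exact fun x hx y hy => (hosc x hx y hy).2.1
    · exact fun x hx y hy => (hosc x hx y hy).2.2
  set γQ := γ₀.map fun p => (p.1, Q p.2) with hγQ
  have hγQfst : γQ.map Prod.fst = γ₀.map Prod.fst := by
    rw [hγQ, Measure.map_map measurable_fst hmQ]; rfl
  have hγQsnd : γQ.map Prod.snd = (γ₀.map Prod.snd).map Q := by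
    rw [hγQ, Measure.map_map measurable_snd hmQ, Measure.map_map hQ measurable_snd]; rfl
  have hγQK : ∀ᵐ p ∂γQ, p.1 ∈ K ∧ p.2 ∈ K := by
    refine (ae_map_iff hmQ.aemeasurable
      ((measurable_fst hK.measurableSet).inter (measurable_snd hK.measurableSet))).2 ?_
    exact hγ₀.mono fun p hp => ⟨hp.1, hQK _⟩
  obtain ⟨γn, _, hn1, hn2, hnmin⟩ := exists_lexMin 0 (c + s • g) hK hγQK
  have hnK := ae_mem_and_mem_of_marginals hK.measurableSet hγQK hn1 hn2
  have hnY : ∀ᵐ p ∂γn, p.2 ∈ Y := by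
    refine ae_of_ae_map (μ := γn) measurable_snd.aemeasurable (p := fun y => y ∈ Y) ?_
    rw [hn2, hγQsnd]
    exact (ae_map_iff hQ.aemeasurable Y.measurableSet).2 (Filter.Eventually.of_forall hQY)
  have hkn := hb s hs0 γn Y hnmin (hn1.trans hγQfst) hnK hnY
  have : Nonempty E := ⟨hne.some⟩
  obtain ⟨γ', hfin, h1, h2, hlift⟩ :=
    exists_lift_of_map_snd hQ (hn1.trans hγQfst) (hn2.trans hγQsnd)
  have hmem : (⟨γ', hfin⟩ : FiniteMeasure (E × E)) ∈ plans γ₀ := ⟨h1, h2⟩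
  have hmem₀ : (⟨γ₀, inferInstance⟩ : FiniteMeasure (E × E)) ∈ plans γ₀ := ⟨rfl, rfl⟩
  have hq' := hquant _ hmem
  have hq₀ := hquant _ hmem₀
  simp only [FiniteMeasure.toMeasure_mk, hlift, ← hγQ, Set.mem_insert_iff, Set.mem_singleton_iff,
    forall_eq_or_imp, forall_eq, abs_le] at hq' hq₀
  have hopt := (hnmin γQ inferInstance hn1.symm hn2.symm).2 (by simp)
  have hsplit (m : Measure (E × E)) [IsFiniteMeasure m] :
      ∫ p, (c + s • g) p ∂m = ∫ p, c p ∂m + s * ∫ p, g p ∂m := by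
    rw [← integral_const_mul, ← integral_add (c.integrable _) ((g.integrable _).const_mul _)]
    rfl
  rw [hsplit, hsplit] at hopt
  have hcmin := (h γ' hfin h1 h2).1
  have hgle : ∀ (m : Measure (E × E)) [IsFiniteMeasure m], m.real Set.univ = M →
      |∫ p, g p ∂m| ≤ ‖g‖ * M := by
    intro m _ hm
    rw [← Real.norm_eq_abs, ← hm]
    exact norm_integral_le_of_norm_le_const
      (Filter.Eventually.of_forall fun p => g.norm_coe_le_norm p)
  have hMγ' : γ'.real Set.univ = M := by
    have := congrArg (fun m => m.real Set.univ) h1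
    simpa only [map_measureReal_apply measurable_fst MeasurableSet.univ, Set.preimage_univ]
      using this
  have hg' := abs_le.1 (hgle γ' hMγ')
  have hg₀ := abs_le.1 (hgle γ₀ rfl)
  obtain ⟨hc', hg'q, hk'⟩ := hq'
  obtain ⟨hc₀, hg₀q, hk₀⟩ := hq₀
  have hgM : 0 ≤ ‖g‖ * M := by positivity
  have hsM : s * s * M ≤ s * M := by nlinarith [mul_nonneg hs0.le hM0]
  have hssM : s * (s * s * M) ≤ s * (s * M) := mul_le_mul_of_nonneg_left hsM hs0.le
  have ecross : s * ∫ p, g p ∂γ' ≤ s * ∫ p, g p ∂γn + s * (s * s * M) := by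
    rw [← mul_add]; exact mul_le_mul_of_nonneg_left (by linarith) hs0.le
  have ecross₀ : s * ∫ p, g p ∂γQ ≤ s * ∫ p, g p ∂γ₀ + s * (s * s * M) := by
    rw [← mul_add]; exact mul_le_mul_of_nonneg_left (by linarith) hs0.le
  have hsA' : s * A = 4 * (s * M) + 2 * (s * (‖g‖ * M)) := by rw [hA]; ring
  have hgs' : s * -(‖g‖ * M) ≤ s * ∫ p, g p ∂γ' := mul_le_mul_of_nonneg_left hg'.1 hs0.le
  have hgs₀ : s * ∫ p, g p ∂γ₀ ≤ s * (‖g‖ * M) := mul_le_mul_of_nonneg_left hg₀.2 hs0.le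
  have hsg : 0 ≤ s * (‖g‖ * M) := by positivity
  have hsM0 : 0 ≤ s * M := by positivity
  have hssM' : s * (s * M) ≤ s * M := by nlinarith
  refine ⟨⟨γ', hfin⟩, hmem, ?_, ?_, ?_⟩
  · simp only [FiniteMeasure.toMeasure_mk]
    nlinarith
  · simp only [FiniteMeasure.toMeasure_mk]
    have : s * ∫ p, g p ∂γ' ≤ s * (∫ p, g p ∂γ₀ + 4 * (s * M)) := by nlinarith
    have := le_of_mul_le_mul_left this hs0
    linarith
  · simp only [FiniteMeasure.toMeasure_mk]
    linarith

/-- A bound valid for minimizers with finitely many targets, for costs perturbed by `q - r • k`,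
passes to the lexicographic minimizer of `(c, q)`. -/
theorem LexMin.integral_le_of_quantized {c q : E × E →ᵇ ℝ} {γ₀ : Measure (E × E)}
    [IsFiniteMeasure γ₀] (h : LexMin c q γ₀) {K : Set E} (hK : IsCompact K) (hne : K.Nonempty)
    (hγ₀ : ∀ᵐ p ∂γ₀, p.1 ∈ K ∧ p.2 ∈ K) (k : E × E →ᵇ ℝ) {r : ℝ} (hr : 0 < r) {b : ℝ}
    (hb : ∀ s : ℝ, 0 < s → ∀ (γ : Measure (E × E)) [IsFiniteMeasure γ] (Y : Finset E),
      LexMin 0 (c + s • (q - r • k)) γ → γ.map Prod.fst = γ₀.map Prod.fst →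
      (∀ᵐ p ∂γ, p.1 ∈ K ∧ p.2 ∈ K) → (∀ᵐ p ∂γ, p.2 ∈ Y) → ∫ p, k p ∂γ ≤ b) :
    ∫ p, k p ∂γ₀ ≤ b := by
  set g := q - r • k with hg
  let D : FiniteMeasure (E × E) → ℝ := fun γ =>
    max (∫ p, c p ∂(γ : Measure (E × E)) - ∫ p, c p ∂γ₀)
      (max (∫ p, g p ∂(γ : Measure (E × E)) - ∫ p, g p ∂γ₀)
        (∫ p, k p ∂(γ : Measure (E × E)) - b))
  have hD : Continuous D :=
    ((FiniteMeasure.continuous_integral c).sub continuous_const).max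
      (((FiniteMeasure.continuous_integral g).sub continuous_const).max
        ((FiniteMeasure.continuous_integral k).sub continuous_const))
  obtain ⟨γ, hγ, hmin⟩ := (isCompact_plans hK hγ₀).exists_isMinOn
    ⟨⟨γ₀, inferInstance⟩, rfl, rfl⟩ hD.continuousOn
  have hD0 : D γ ≤ 0 := by
    refine le_of_forall_pos_le_add fun η hη => ?_
    obtain ⟨γ', hγ', h1, h2, h3⟩ := h.exists_almost_minimizer hK hne hγ₀ g k hb hη
    refine le_trans (hmin hγ') ?_
    simp only [D, max_le_iff]
    exact ⟨by linarith, by linarith, by linarith⟩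
  simp only [D, max_le_iff] at hD0
  have hq := (h γ inferInstance hγ.1 hγ.2).2 (by linarith)
  have hsplit (m : Measure (E × E)) [IsFiniteMeasure m] :
      ∫ p, g p ∂m = ∫ p, q p ∂m - r * ∫ p, k p ∂m := by
    rw [← integral_const_mul, ← integral_sub (q.integrable _) ((k.integrable _).const_mul _)]
    rfl
  rw [hsplit, hsplit] at hD0
  have : r * ∫ p, k p ∂γ₀ ≤ r * ∫ p, k p ∂(γ : Measure (E × E)) := by linarith
  have := le_of_mul_le_mul_left this hr
  linarith

end Approximation

section DensityBound

variable {E : Type*} [NormedAddCommGroup E] [InnerProductSpace ℝ E] [FiniteDimensional ℝ E]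
  [MeasurableSpace E] [BorelSpace E]

theorem LexMin.lintegral_map_interp_le {f : E → ℝ} (hf : ConvexOn ℝ Set.univ f) {c q : E × E →ᵇ ℝ}
    {K : Set E} (hK : IsCompact K) (hne : K.Nonempty)
    (hc : ∀ x ∈ K, ∀ y ∈ K, c (x, y) = f (y - x))
    (hq : ∀ x ∈ K, ∀ y ∈ K, q (x, y) = ‖y - x‖ ^ 2) {γ₀ : Measure (E × E)} [IsFiniteMeasure γ₀]
    (h : LexMin c q γ₀) (hγ₀ : ∀ᵐ p ∂γ₀, p.1 ∈ K ∧ p.2 ∈ K) {l : Measure E} [l.IsAddHaarMeasure]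
    (hfst : γ₀.map Prod.fst ≤ l) {t : ℝ} (ht : t ∈ Set.Ioo 0 1) {N : ℝ} (hN : 0 < N) (χ : E →ᵇ ℝ)
    (hχ : Semiconvex N χ) (hχ0 : ∀ z, 0 ≤ χ z) :
    ∫⁻ z, ENNReal.ofReal (χ z) ∂(γ₀.map (interp t)) ≤
      ∫⁻ z, ENNReal.ofReal (χ z) ∂(ENNReal.ofReal (((1 - t) ^ Module.finrank ℝ E)⁻¹) • l) := by
  have := FiniteDimensional.complete ℝ E
  have := FiniteDimensional.proper ℝ E
  set B := ∫⁻ z, ENNReal.ofReal (χ z) ∂(ENNReal.ofReal (((1 - t) ^ Module.finrank ℝ E)⁻¹) • l)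
  rcases eq_or_ne B ∞ with hB | hB
  · rw [hB]; exact le_top
  set k : E × E →ᵇ ℝ := χ.compContinuous ⟨interp t, continuous_interp t⟩ with hk
  have hki (γ : Measure (E × E)) [IsFiniteMeasure γ] :
      ∫⁻ z, ENNReal.ofReal (χ z) ∂(γ.map (interp t)) = ENNReal.ofReal (∫ p, k p ∂γ) := by
    rw [ofReal_integral_eq_lintegral_ofReal (k.integrable _)
      (Filter.Eventually.of_forall fun p => hχ0 _),
      lintegral_map (by fun_prop) (continuous_interp t).measurable]
    rfl
  rw [hki, ENNReal.ofReal_le_iff_le_toReal hB]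
  refine h.integral_le_of_quantized hK hne hγ₀ k (inv_pos.2 hN)
    fun s hs γ _ Y hγ hγfst hγK hγY => ?_
  have hswap := swapDecreasing_of_convexOn hf hc hq ht hN χ hχ
  have hswap' : SwapDecreasing 0 (c + s • (q - N⁻¹ • k)) t K := by
    intro x hx y hy x' hx' y' hy' hcross hyy
    obtain ⟨h1, h2⟩ := hswap x hx y hy x' hx' y' hy' hcross hyy
    refine ⟨by simp, ?_⟩
    have := mul_lt_mul_of_pos_left h2 hs
    simp only [coe_add, coe_smul, Pi.add_apply, smul_eq_mul]
    rw [← hk] at this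
    linarith
  have hle := hγ.map_interp_le_of_finite hswap' hγK (hγfst.trans_le hfst) ht.2 Y hγY
  rw [← ENNReal.ofReal_le_iff_le_toReal hB, ← hki]
  exact lintegral_mono' hle le_rfl

/-- The interpolant at time `t` of a lexicographic minimizer whose first marginal has density at
most `1` has density at most `(1 - t)⁻ⁿ`. -/
theorem LexMin.map_interp_le {f : E → ℝ} (hf : ConvexOn ℝ Set.univ f) {c q : E × E →ᵇ ℝ}
    {K : Set E} (hK : IsCompact K) (hne : K.Nonempty)
    (hc : ∀ x ∈ K, ∀ y ∈ K, c (x, y) = f (y - x))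
    (hq : ∀ x ∈ K, ∀ y ∈ K, q (x, y) = ‖y - x‖ ^ 2) {γ₀ : Measure (E × E)} [IsFiniteMeasure γ₀]
    (h : LexMin c q γ₀) (hγ₀ : ∀ᵐ p ∂γ₀, p.1 ∈ K ∧ p.2 ∈ K) {l : Measure E} [l.IsAddHaarMeasure]
    (hfst : γ₀.map Prod.fst ≤ l) {t : ℝ} (ht : t ∈ Set.Ioo 0 1) :
    γ₀.map (interp t) ≤ ENNReal.ofReal (((1 - t) ^ Module.finrank ℝ E)⁻¹) • l := by
  have := FiniteDimensional.proper ℝ E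
  set ξ := ENNReal.ofReal (((1 - t) ^ Module.finrank ℝ E)⁻¹) • l with hξ
  have : IsFiniteMeasureOnCompacts ξ :=
    ⟨fun F hF => by
      rw [hξ, Measure.smul_apply, smul_eq_mul]
      exact ENNReal.mul_lt_top ENNReal.ofReal_lt_top hF.measure_lt_top⟩
  have hcompact : ∀ F : Set E, IsCompact F → γ₀.map (interp t) F ≤ ξ F := by
    intro F hF
    rcases F.eq_empty_or_nonempty with rfl | hFne
    · simp
    refine ge_of_tendsto ((tendsto_measure_cthickening_of_isCompact (μ := ξ) hF).mono_left
      (nhdsWithin_le_nhds (s := Set.Ioi 0))) ?_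
    filter_upwards [self_mem_nhdsWithin] with δ (hδ : 0 < δ)
    set N := (δ ^ 2)⁻¹ with hN
    have hN0 : 0 < N := by positivity
    let χ : E →ᵇ ℝ := BoundedContinuousFunction.ofNormedAddCommGroup
      (fun z => max 0 (1 - N * Metric.infDist z F ^ 2))
      (by have := Metric.continuous_infDist_pt F; fun_prop) 1 fun z => by
        rw [Real.norm_of_nonneg (le_max_left _ _)]
        exact max_le zero_le_one (sub_le_self _ (by positivity))
    calc γ₀.map (interp t) F = ∫⁻ z in F, 1 ∂(γ₀.map (interp t)) := by simp
      _ ≤ ∫⁻ z in F, ENNReal.ofReal (χ z) ∂(γ₀.map (interp t)) := by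
          refine setLIntegral_mono' hF.measurableSet fun z hz => ?_
          change 1 ≤ ENNReal.ofReal (max 0 (1 - N * Metric.infDist z F ^ 2))
          simp [Metric.infDist_zero_of_mem hz]
      _ ≤ ∫⁻ z, ENNReal.ofReal (χ z) ∂(γ₀.map (interp t)) := setLIntegral_le_lintegral _ _
      _ ≤ ∫⁻ z, ENNReal.ofReal (χ z) ∂ξ :=
          h.lintegral_map_interp_le hf hK hne hc hq hγ₀ hfst ht hN0 χ
            (semiconvex_max_zero_sub_infDist_sq hF hFne hN0.le) fun z => le_max_left _ _
      _ ≤ ∫⁻ z, (Metric.cthickening δ F).indicator 1 z ∂ξ := by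
          refine lintegral_mono fun z => ?_
          change ENNReal.ofReal (max 0 (1 - N * Metric.infDist z F ^ 2)) ≤ _
          by_cases hz : z ∈ Metric.cthickening δ F
          · rw [Set.indicator_of_mem hz, Pi.one_apply, ENNReal.ofReal_le_one]
            exact max_le zero_le_one (sub_le_self _ (by positivity))
          · rw [Set.indicator_of_notMem hz, nonpos_iff_eq_zero, ENNReal.ofReal_eq_zero,
              max_le_iff]
            refine ⟨le_rfl, ?_⟩
            have hd : δ < Metric.infDist z F := by
              by_contra! hle
              exact hz ((hF.cthickening_eq_biUnion_closedBall hδ.le).symm ▸ by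
                obtain ⟨a, ha, hza⟩ := hF.exists_infDist_eq_dist hFne z
                exact Set.mem_iUnion₂.2 ⟨a, ha, by rw [Metric.mem_closedBall, ← hza]; exact hle⟩)
            have : δ ^ 2 ≤ Metric.infDist z F ^ 2 := pow_le_pow_left₀ hδ.le hd.le 2
            have : N * δ ^ 2 ≤ N * Metric.infDist z F ^ 2 :=
              mul_le_mul_of_nonneg_left this hN0.le
            have : N * δ ^ 2 = 1 := inv_mul_cancel₀ (by positivity)
            linarith
      _ = ξ (Metric.cthickening δ F) := by
          rw [lintegral_indicator_one Metric.isClosed_cthickening.measurableSet]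
  refine Measure.le_iff.2 fun A hA => ?_
  rw [hA.measure_eq_iSup_isCompact]
  exact iSup₂_le fun F hFA => iSup_le fun hF => (hcompact F hF).trans (measure_mono hFA)

end DensityBound

section Deterministic

theorem exists_le_map_fst_eq {X Y : Type*} [MeasurableSpace X] [MeasurableSpace Y]
    [StandardBorelSpace Y] [Nonempty Y] (m : Measure (X × Y)) [IsFiniteMeasure m] {τ : Measure X}
    (hτ : τ ≤ m.map Prod.fst) : ∃ m' ≤ m, m'.map Prod.fst = τ := by
  have : IsFiniteMeasure τ := isFiniteMeasure_of_le _ hτ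
  refine ⟨τ ⊗ₘ m.condKernel, ?_, Measure.fst_compProd _ _⟩
  have hdis : m.fst ⊗ₘ m.condKernel = m := m.disintegrate m.condKernel
  conv_rhs => rw [← hdis]
  refine Measure.le_iff.2 fun s hs => ?_
  rw [Measure.compProd_apply hs, Measure.compProd_apply hs]
  exact lintegral_mono' hτ le_rfl

theorem exists_restrict_le_smul {X : Type*} [TopologicalSpace X] [MeasurableSpace X] [BorelSpace X]
    {l σ : Measure X} [SigmaFinite l] [l.InnerRegularCompactLTTop] [IsFiniteMeasure σ]
    (hσ : σ ≪ l) (h0 : σ ≠ 0) :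
    ∃ (N : ℝ≥0) (X₀ : Set X), N ≠ 0 ∧ IsCompact X₀ ∧ l X₀ ≠ 0 ∧ l X₀ ≠ ∞ ∧
      l.restrict X₀ ≤ N • σ := by
  have hd : l.withDensity (σ.rnDeriv l) = σ := Measure.withDensity_rnDeriv_eq _ _ hσ
  have hm := Measure.measurable_rnDeriv σ l
  obtain ⟨n, hn⟩ : ∃ n : ℕ, l {x | ((n : ℝ≥0∞) + 1)⁻¹ ≤ σ.rnDeriv l x} ≠ 0 := by
    by_contra! hcon
    apply h0
    rw [← hd, withDensity_eq_zero_iff hm.aemeasurable]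
    have : ∀ᵐ x ∂l, ∀ n : ℕ, ¬ ((n : ℝ≥0∞) + 1)⁻¹ ≤ σ.rnDeriv l x :=
      ae_all_iff.2 fun n => measure_eq_zero_iff_ae_notMem.1 (hcon n)
    filter_upwards [this] with x hx
    by_contra hx0
    obtain ⟨n, hn⟩ := ENNReal.exists_inv_nat_lt hx0
    exact hx n ((ENNReal.inv_le_inv.2 le_self_add).trans hn.le)
  set S := {x | ((n : ℝ≥0∞) + 1)⁻¹ ≤ σ.rnDeriv l x}
  have hS : MeasurableSet S := measurableSet_le measurable_const hm
  obtain ⟨S', hS'S, hS', hS'0, hS'top⟩ :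
      ∃ S' ⊆ S, MeasurableSet S' ∧ 0 < l S' ∧ l S' < ∞ := by
    obtain ⟨S', hS', h1, h2, h3⟩ := Measure.exists_subset_measure_lt_top hS (pos_iff_ne_zero.2 hn)
    exact ⟨S', h1, hS', h2, h3⟩
  obtain ⟨X₀, hX₀, hX₀c, hpos⟩ := hS'.exists_lt_isCompact_of_ne_top hS'top.ne hS'0
  have hle : ((n : ℝ≥0∞) + 1)⁻¹ • l.restrict X₀ ≤ σ := by
    calc ((n : ℝ≥0∞) + 1)⁻¹ • l.restrict X₀ =
          (l.restrict X₀).withDensity fun _ => ((n : ℝ≥0∞) + 1)⁻¹ := (withDensity_const _).symm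
      _ ≤ (l.restrict X₀).withDensity (σ.rnDeriv l) := by
          refine withDensity_mono ?_
          refine ae_mono (Measure.restrict_mono (hX₀.trans hS'S) le_rfl) ?_
          exact ae_restrict_mem hS
      _ ≤ l.withDensity (σ.rnDeriv l) := by
          refine Measure.le_iff.2 fun s hs => ?_
          rw [withDensity_apply _ hs, withDensity_apply _ hs]
          exact lintegral_mono' (Measure.restrict_mono le_rfl Measure.restrict_le_self) le_rfl
      _ = σ := hd
  refine ⟨n + 1, X₀, by positivity, hX₀c, hpos.ne', ((measure_mono hX₀).trans_lt hS'top).ne, ?_⟩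
  refine Measure.le_iff.2 fun s hs => ?_
  have := hle s
  rw [Measure.smul_apply, smul_eq_mul, ENNReal.inv_mul_le_iff (by simp) (by simp)] at this
  simpa [ENNReal.smul_def] using this

/-- A measure on a product which does not split mass is carried by a graph. -/
theorem exists_graph_of_mutuallySingular {X E : Type*} [MeasurableSpace X] [NormedAddCommGroup E]
    [NormedSpace ℝ E] [CompleteSpace E] [SecondCountableTopology E] [MeasurableSpace E]
    [BorelSpace E] (γ : Measure (X × E)) [IsFiniteMeasure γ]
    (h : ∀ B : Set E, MeasurableSet B → (γ.restrict (Prod.snd ⁻¹' B)).map Prod.fst ⟂ₘ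
      (γ.restrict (Prod.snd ⁻¹' B)ᶜ).map Prod.fst) :
    ∃ T : X → E, Measurable T ∧ γ = (γ.map Prod.fst).map fun x => (x, T x) := by
  set κ := γ.condKernel with hκ
  have hdis : γ.fst ⊗ₘ κ = γ := γ.disintegrate γ.condKernel
  have hzero : ∀ S : Set X, MeasurableSet S → ∀ B : Set E, MeasurableSet B →
      (γ.restrict (Prod.snd ⁻¹' B)).map Prod.fst S = 0 → ∀ᵐ x ∂γ.fst, x ∈ S → κ x B = 0 := by
    intro S hS B hB h0
    rw [Measure.map_apply measurable_fst hS, Measure.restrict_apply (measurable_fst hS),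
      ← hdis] at h0
    change (γ.fst ⊗ₘ κ) (S ×ˢ B) = 0 at h0
    rw [Measure.compProd_apply_prod hS hB, lintegral_eq_zero_iff
      (ProbabilityTheory.Kernel.measurable_coe _ hB)] at h0
    exact (ae_restrict_iff' hS).1 h0
  have hzeroone : ∀ B : Set E, MeasurableSet B → ∀ᵐ x ∂γ.fst, κ x B = 0 ∨ κ x Bᶜ = 0 := by
    intro B hB
    obtain ⟨S, hS, h1, h2⟩ := h B hB
    filter_upwards [hzero S hS B hB h1, hzero Sᶜ hS.compl Bᶜ hB.compl h2] with x hx1 hx2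
    by_cases hxS : x ∈ S
    exacts [Or.inl (hx1 hxS), Or.inr (hx2 hxS)]
  have hae : ∀ᵐ x ∂γ.fst, ∀ U ∈ TopologicalSpace.countableBasis E, κ x U = 0 ∨ κ x Uᶜ = 0 :=
    (ae_ball_iff (TopologicalSpace.countable_countableBasis E)).2 fun U hU =>
      hzeroone U (TopologicalSpace.isOpen_of_mem_countableBasis hU).measurableSet
  have hT : StronglyMeasurable fun x => ∫ y, y ∂(κ x) :=
    (stronglyMeasurable_id.comp_measurable measurable_snd).integral_kernel_prod_right'
      (κ := κ) (f := fun p : X × E => p.2)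
  refine ⟨fun x => ∫ y, y ∂(κ x), hT.measurable, ?_⟩
  have hdirac : ∀ᵐ x ∂γ.fst, ∀ᵐ y ∂(κ x), y = ∫ y, y ∂(κ x) := by
    filter_upwards [hae] with x hx
    have h1 : ∀ᵐ y ∂(κ x), ∀ U ∈ TopologicalSpace.countableBasis E, y ∈ U → κ x Uᶜ = 0 := by
      refine (ae_ball_iff (TopologicalSpace.countable_countableBasis E)).2 fun U hU => ?_
      rcases hx U hU with h0 | h0
      · filter_upwards [measure_eq_zero_iff_ae_notMem.1 h0] with y hy hyU using absurd hyU hy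
      · exact Filter.Eventually.of_forall fun _ _ => h0
    obtain ⟨y₀, hy₀⟩ := h1.exists
    have h2 : ∀ᵐ y ∂(κ x), ∀ U ∈ TopologicalSpace.countableBasis E, y₀ ∈ U → y ∈ U := by
      refine (ae_ball_iff (TopologicalSpace.countable_countableBasis E)).2 fun U hU => ?_
      by_cases hyU : y₀ ∈ U
      · filter_upwards [measure_eq_zero_iff_ae_notMem.1 (hy₀ U hU hyU)] with y hy _
        exact not_not.1 hy
      · exact Filter.Eventually.of_forall fun _ h => absurd h hyU
    have h3 : ∀ᵐ y ∂(κ x), y = y₀ := by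
      filter_upwards [h2] with y hy
      by_contra hne
      obtain ⟨U, hU, hyU, hsub⟩ :=
        (TopologicalSpace.isBasis_countableBasis E).exists_subset_of_mem_open
          (Set.mem_compl_singleton_iff.2 (Ne.symm hne)) isOpen_compl_singleton
      exact hsub (hy U hU hyU) rfl
    have h4 : ∫ y, y ∂(κ x) = y₀ := by
      rw [integral_congr_ae h3]
      simp
    rw [h4]
    exact h3
  have hms : MeasurableSet {p : X × E | p.2 = ∫ y, y ∂(κ p.1)} :=
    measurableSet_eq_fun measurable_snd (hT.measurable.comp measurable_fst)
  have hgraph : ∀ᵐ p ∂γ, (p.1, ∫ y, y ∂(κ p.1)) = p := by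
    rw [← hdis]
    filter_upwards [Measure.ae_compProd_of_ae_ae hms hdirac] with p hp
    exact Prod.ext rfl hp.symm
  have hg : Measurable fun x => (x, ∫ y, y ∂(κ x)) := measurable_id.prodMk hT.measurable
  beta_reduce
  rw [Measure.map_map hg measurable_fst]
  conv_lhs => rw [← Measure.map_id (μ := γ)]
  exact Measure.map_congr (hgraph.mono fun p hp => hp.symm)

end Deterministic

section NoSplitting

variable {E : Type*} [NormedAddCommGroup E] [InnerProductSpace ℝ E] [FiniteDimensional ℝ E]
  [MeasurableSpace E] [BorelSpace E]

theorem measure_le_map_interp_cthickening {γ : Measure (E × E)} {K X₀ : Set E}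
    (hK : Bornology.IsBounded K) (hX₀ : MeasurableSet X₀) (hγ : ∀ᵐ p ∂γ, p.1 ∈ K ∧ p.2 ∈ K)
    {l : Measure E} (hfst : γ.map Prod.fst = l.restrict X₀) {t : ℝ} (ht : 0 ≤ t) :
    l X₀ ≤ γ.map (interp t) (Metric.cthickening (t * Metric.diam K) X₀) := by
  rw [Measure.map_apply (continuous_interp t).measurable Metric.isClosed_cthickening.measurableSet]
  calc l X₀ = l.restrict X₀ X₀ := by rw [Measure.restrict_apply_self]
    _ = γ (Prod.fst ⁻¹' X₀) := by rw [← hfst, Measure.map_apply measurable_fst hX₀]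
    _ ≤ _ := by
        refine measure_mono_ae ?_
        filter_upwards [hγ] with p hp (hpX : p.1 ∈ X₀)
        refine Metric.mem_cthickening_of_dist_le _ p.1 _ _ hpX ?_
        have : interp t p - p.1 = t • (p.2 - p.1) := by
          unfold interp; module
        rw [dist_eq_norm, this, norm_smul, Real.norm_of_nonneg ht, ← dist_eq_norm]
        exact mul_le_mul_of_nonneg_left (Metric.dist_le_diam_of_mem hK hp.2 hp.1) ht

/-- A lexicographic minimizer with absolutely continuous first marginal does not split mass. -/
theorem LexMin.map_fst_mutuallySingular {f : E → ℝ} (hf : ConvexOn ℝ Set.univ f)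
    {c q : E × E →ᵇ ℝ} {K : Set E} (hK : IsCompact K) (hne : K.Nonempty)
    (hc : ∀ x ∈ K, ∀ y ∈ K, c (x, y) = f (y - x))
    (hq : ∀ x ∈ K, ∀ y ∈ K, q (x, y) = ‖y - x‖ ^ 2) {γ : Measure (E × E)} [IsFiniteMeasure γ]
    (h : LexMin c q γ) (hγ : ∀ᵐ p ∂γ, p.1 ∈ K ∧ p.2 ∈ K) {l : Measure E} [l.IsAddHaarMeasure]
    (hac : γ.map Prod.fst ≪ l) {B : Set E} (hB : MeasurableSet B) :
    (γ.restrict (Prod.snd ⁻¹' B)).map Prod.fst ⟂ₘ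
      (γ.restrict (Prod.snd ⁻¹' B)ᶜ).map Prod.fst := by
  have := FiniteDimensional.complete ℝ E
  have := FiniteDimensional.proper ℝ E
  have : Nonempty E := ⟨hne.some⟩
  by_contra hsing
  obtain ⟨σ, hσ₁, hσ₂, hσ⟩ : ∃ σ : Measure E, σ ≤ (γ.restrict (Prod.snd ⁻¹' B)).map Prod.fst ∧
      σ ≤ (γ.restrict (Prod.snd ⁻¹' B)ᶜ).map Prod.fst ∧ σ ≠ 0 := by
    rw [Measure.mutuallySingular_iff_disjoint, Disjoint] at hsing
    push Not at hsing
    obtain ⟨σ, h₁, h₂, h₃⟩ := hsing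
    exact ⟨σ, h₁, h₂, fun h => h₃ h.le⟩
  have : IsFiniteMeasure σ := isFiniteMeasure_of_le _ hσ₁
  have hσl : σ ≪ l := (Measure.absolutelyContinuous_of_le
    (hσ₁.trans (Measure.map_mono Measure.restrict_le_self measurable_fst))).trans hac
  obtain ⟨N, X₀, hN, hX₀, hpos, hfin, hle⟩ := exists_restrict_le_smul hσl hσ
  have hpiece : ∀ A : Set (E × E), σ ≤ (γ.restrict A).map Prod.fst →
      ∃ m : Measure (E × E), m ≪ γ.restrict A ∧ IsFiniteMeasure m ∧
        m.map Prod.fst = l.restrict X₀ ∧ (∀ᵐ p ∂m, p.1 ∈ K ∧ p.2 ∈ K) ∧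
        ∀ t ∈ Set.Ioo (0 : ℝ) 1,
          m.map (interp t) ≤ ENNReal.ofReal (((1 - t) ^ Module.finrank ℝ E)⁻¹) • l := by
    intro A hA
    have hle' : l.restrict X₀ ≤ (N • γ.restrict A).map Prod.fst := by
      rw [Measure.map_smul]
      refine hle.trans (Measure.le_iff.2 fun s _ => ?_)
      rw [Measure.smul_apply, Measure.smul_apply]
      exact mul_le_mul_right (hA s) _
    obtain ⟨m, hm, hmfst⟩ := exists_le_map_fst_eq (N • γ.restrict A) hle'
    have hmγ : m ≤ N • γ := by
      refine hm.trans (Measure.le_iff.2 fun s _ => ?_)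
      rw [Measure.smul_apply, Measure.smul_apply]
      exact mul_le_mul_right (Measure.restrict_le_self s) _
    have hmfin : IsFiniteMeasure m := isFiniteMeasure_of_le _ hmγ
    have hmac : m ≪ γ.restrict A :=
      (Measure.absolutelyContinuous_of_le hm).trans Measure.smul_absolutelyContinuous
    have hmK : ∀ᵐ p ∂m, p.1 ∈ K ∧ p.2 ∈ K := hmac.ae_le (ae_restrict_of_ae hγ)
    exact ⟨m, hmac, hmfin, hmfst, hmK, fun t ht =>
      ((h.smul hN).mono hmγ).map_interp_le hf hK hne hc hq hmK
        (hmfst.trans_le Measure.restrict_le_self) ht⟩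
  obtain ⟨m₁, hm₁, _, hfst₁, hK₁, hd₁⟩ := hpiece _ hσ₁
  obtain ⟨m₂, hm₂, _, hfst₂, hK₂, hd₂⟩ := hpiece _ hσ₂
  have hbound : ∀ t ∈ Set.Ioo (0 : ℝ) 1, l X₀ + l X₀ ≤
      ENNReal.ofReal (((1 - t) ^ Module.finrank ℝ E)⁻¹) *
        l (Metric.cthickening (t * Metric.diam K) X₀) := by
    intro t ht
    have hswap := swapDecreasing_of_convexOn hf hc hq ht one_pos 0 (by intro z h; simp)
    have hsing : m₁.map (interp t) ⟂ₘ m₂.map (interp t) :=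
      (h.mutuallySingular (t := t) (K := K) (by
        intro x hx y hy x' hx' y' hy' h1 h2
        simpa using hswap x hx y hy x' hx' y' hy' h1 h2) hγ hB).mono_ac
        (hm₁.map (continuous_interp t).measurable) (hm₂.map (continuous_interp t).measurable)
    calc l X₀ + l X₀ ≤ (m₁.map (interp t) + m₂.map (interp t))
          (Metric.cthickening (t * Metric.diam K) X₀) :=
          add_le_add
            (measure_le_map_interp_cthickening hK.isBounded hX₀.measurableSet hK₁ hfst₁ ht.1.le)
            (measure_le_map_interp_cthickening hK.isBounded hX₀.measurableSet hK₂ hfst₂ ht.1.le)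
      _ ≤ _ := add_le_of_mutuallySingular (hd₁ t ht) (hd₂ t ht) hsing _
  have hlim1 : Filter.Tendsto (fun t : ℝ => ENNReal.ofReal (((1 - t) ^ Module.finrank ℝ E)⁻¹))
      (nhdsWithin 0 (Set.Ioi 0)) (nhds 1) := by
    have hcont : ContinuousAt (fun t : ℝ => ENNReal.ofReal (((1 - t) ^ Module.finrank ℝ E)⁻¹)) 0 :=
      ENNReal.continuous_ofReal.continuousAt.comp
        (ContinuousAt.inv₀ (by fun_prop) (by simp))
    have := hcont.tendsto
    simp only [sub_zero, one_pow, inv_one, ENNReal.ofReal_one] at this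
    exact this.mono_left nhdsWithin_le_nhds
  have hlim2 : Filter.Tendsto (fun t : ℝ => l (Metric.cthickening (t * Metric.diam K) X₀))
      (nhdsWithin 0 (Set.Ioi 0)) (nhds (l X₀)) := by
    refine (tendsto_measure_cthickening_of_isCompact hX₀).comp ?_
    have : ContinuousAt (fun t : ℝ => t * Metric.diam K) 0 := by fun_prop
    have := this.tendsto
    rw [zero_mul] at this
    exact this.mono_left nhdsWithin_le_nhds
  have hlim := ENNReal.Tendsto.mul hlim1 (Or.inl one_ne_zero) hlim2 (Or.inr ENNReal.one_ne_top)
  rw [one_mul] at hlim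
  have hcontra : l X₀ + l X₀ ≤ l X₀ :=
    ge_of_tendsto hlim (Filter.mem_of_superset (Ioo_mem_nhdsGT one_pos) hbound)
  have := ENNReal.lt_add_right hfin hpos
  exact absurd hcontra (not_le.2 this)

end NoSplitting

theorem IsCompact.exists_boundedContinuousFunction_eqOn {X : Type*} [TopologicalSpace X]
    {K : Set X} (hK : IsCompact K) {F : X → ℝ} (hF : Continuous F) :
    ∃ G : X →ᵇ ℝ, Set.EqOn G F K := by
  obtain ⟨C, hC⟩ := hK.exists_bound_of_continuousOn hF.continuousOn
  refine ⟨BoundedContinuousFunction.ofNormedAddCommGroup (fun x => max (-|C|) (min |C| (F x)))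
    (by fun_prop) |C| fun x => ?_, fun x hx => ?_⟩
  · rw [Real.norm_eq_abs, abs_le]
    exact ⟨le_max_left _ _, max_le (by linarith [abs_nonneg C]) (min_le_left _ _)⟩
  · have h := abs_le.1 ((hC x hx).trans (le_abs_self C))
    change max (-|C|) (min |C| (F x)) = F x
    rw [min_eq_right h.2, max_eq_right h.1]

end OptimalPlans

/-- Existence of an optimal transport map for a convex cost with superlinear growth
(Monge problem), for compactly supported marginals with `μ` absolutely continuous. -/
theorem monge_existence_convex_cost {d : ℕ} (hd : 1 ≤ d)
    (c : EuclideanSpace ℝ (Fin d) → ℝ)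
    (hconv : ConvexOn ℝ Set.univ c) (hnonneg : ∀ x, 0 ≤ c x)
    (hsuper : Filter.Tendsto (fun x => c x / ‖x‖)
      (Bornology.cobounded (EuclideanSpace ℝ (Fin d))) Filter.atTop)
    (μ ν : Measure (EuclideanSpace ℝ (Fin d)))
    [IsProbabilityMeasure μ] [IsProbabilityMeasure ν]
    (hμK : ∃ K, IsCompact K ∧ μ Kᶜ = 0) (hνK : ∃ K, IsCompact K ∧ ν Kᶜ = 0)
    (hac : μ ≪ MeasureTheory.volume) :
    ∃ T : EuclideanSpace ℝ (Fin d) → EuclideanSpace ℝ (Fin d),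
      Measurable T ∧ μ.map T = ν ∧
      μ.map (fun x => (x, T x)) ∈ Coupling μ ν ∧
      ∀ π ∈ Coupling μ ν,
        ∫⁻ x, ENNReal.ofReal (c (T x - x)) ∂μ ≤
          ∫⁻ p, ENNReal.ofReal (c (p.2 - p.1)) ∂π := by
  have hcont : Continuous c := continuousOn_univ.1 (hconv.continuousOn isOpen_univ)
  obtain ⟨K₁, hK₁, hμK₁⟩ := hμK
  obtain ⟨K₂, hK₂, hνK₂⟩ := hνK
  set K := K₁ ∪ K₂ with hKdef
  have hK : IsCompact K := hK₁.union hK₂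
  have hμae : ∀ᵐ x ∂μ, x ∈ K := by
    have : ∀ᵐ x ∂μ, x ∈ K₁ := hμK₁
    exact this.mono fun x hx => Or.inl hx
  have hνae : ∀ᵐ x ∂ν, x ∈ K := by
    have : ∀ᵐ x ∂ν, x ∈ K₂ := hνK₂
    exact this.mono fun x hx => Or.inr hx
  have hne : K.Nonempty := hμae.exists
  have hprodK : ∀ᵐ p ∂(μ.prod ν), p.1 ∈ K ∧ p.2 ∈ K :=
    (Measure.quasiMeasurePreserving_fst.ae hμae).and (Measure.quasiMeasurePreserving_snd.ae hνae)
  have hprod₁ : (μ.prod ν).map Prod.fst = μ := Measure.fst_prod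
  have hprod₂ : (μ.prod ν).map Prod.snd = ν := Measure.snd_prod
  obtain ⟨C, hC⟩ := (hK.prod hK).exists_boundedContinuousFunction_eqOn
    (F := fun p => c (p.2 - p.1)) (by fun_prop)
  obtain ⟨q, hq⟩ := (hK.prod hK).exists_boundedContinuousFunction_eqOn
    (F := fun p : EuclideanSpace ℝ (Fin d) × EuclideanSpace ℝ (Fin d) => ‖p.2 - p.1‖ ^ 2)
    (by fun_prop)
  obtain ⟨γ, _, hγ₁, hγ₂, hγ⟩ := exists_lexMin C q hK hprodK
  have hsupp := fun π h₁ h₂ => ae_mem_and_mem_of_marginals (γ := π) hK.measurableSet hprodK h₁ h₂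
  rw [hprod₁] at hγ₁ hsupp
  rw [hprod₂] at hγ₂ hsupp
  have hcost : ∀ π : Measure (EuclideanSpace ℝ (Fin d) × EuclideanSpace ℝ (Fin d)),
      IsFiniteMeasure π → π.map Prod.fst = μ → π.map Prod.snd = ν →
      ∫⁻ p, ENNReal.ofReal (c (p.2 - p.1)) ∂π = ENNReal.ofReal (∫ p, C p ∂π) := by
    intro π _ h₁ h₂
    have hae : ∀ᵐ p ∂π, C p = c (p.2 - p.1) := (hsupp π h₁ h₂).mono fun p hp => hC hp
    rw [ofReal_integral_eq_lintegral_ofReal (C.integrable _)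
      (hae.mono fun p hp => hp.symm ▸ hnonneg _)]
    exact lintegral_congr_ae (hae.mono fun p hp => by simp only [hp])
  obtain ⟨T, hT, hgraph⟩ := exists_graph_of_mutuallySingular γ fun B hB =>
    hγ.map_fst_mutuallySingular hconv hK hne (fun x hx y hy => hC (Set.mk_mem_prod hx hy))
      (fun x hx y hy => hq (Set.mk_mem_prod hx hy)) (hsupp γ hγ₁ hγ₂) (hγ₁ ▸ hac) hB
  rw [hγ₁] at hgraph
  have hgT : Measurable fun x => (x, T x) := measurable_id.prodMk hT
  have hγprob : IsProbabilityMeasure γ := by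
    rw [hgraph]
    exact Measure.isProbabilityMeasure_map hgT.aemeasurable
  refine ⟨T, hT, ?_, ?_, ?_⟩
  · rw [← hγ₂, hgraph, Measure.map_map measurable_snd hgT]
    rfl
  · rw [← hgraph]
    exact ⟨hγprob, hγ₁, hγ₂⟩
  · rintro π ⟨_, h₁, h₂⟩
    calc ∫⁻ x, ENNReal.ofReal (c (T x - x)) ∂μ = ∫⁻ p, ENNReal.ofReal (c (p.2 - p.1)) ∂γ := by
          rw [hgraph, lintegral_map (by fun_prop) hgT]
      _ = ENNReal.ofReal (∫ p, C p ∂γ) := hcost γ inferInstance hγ₁ hγ₂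
      _ ≤ ENNReal.ofReal (∫ p, C p ∂π) :=
          ENNReal.ofReal_le_ofReal (hγ π inferInstance (h₁.trans hγ₁.symm) (h₂.trans hγ₂.symm)).1
      _ = _ := (hcost π inferInstance h₁ h₂).symm
end

section
/- Equivalence of the transport problem with its space-time lifting. Let c : ℝ^d → ℝ be convex and nonnegative, and let c̄ be the associated extended cost on ℝ × ℝ^d. Let μ, ν be Borel probability measures on ℝ^d, let μ̄ be the pushforward of μ under x ↦ (1,x) and ν̄ the pushforward of ν under x ↦ (0,x). Then the map sending π to π̄ := pushforward of π under (x,x') ↦ ((1,x),(0,x')) is a bijection from Π(μ,ν) onto Π(μ̄,ν̄); for every π ∈ Π(μ,ν) one has ∫ c̄(z − z') dπ̄(z,z') = ∫ c(x' − x) dπ(x,x') (integrals in [0,∞]); and consequently π minimizes π ↦ ∫ c(x'−x) dπ over Π(μ,ν) if and only if π̄ minimizes γ ↦ ∫ c̄(z−z') dγ over Π(μ̄,ν̄). -/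
open MeasureTheory Classical

/-- The extended (space-time) cost associated to a convex nonnegative cost `c`:
`c̄(t,x) = t · c(-x/t)` for `t > 0`, `c̄(0,0) = 0`, `c̄(0,x) = ∞` for `x ≠ 0`,
and `c̄(t,x) = ∞` for `t < 0`. -/

noncomputable def cbar {d : ℕ} (c : EuclideanSpace ℝ (Fin d) → ℝ) :
    ℝ × EuclideanSpace ℝ (Fin d) → ENNReal := fun z =>
  if 0 < z.1 then ENNReal.ofReal (z.1 * c (-(z.1⁻¹ • z.2)))
  else if z.1 = 0 ∧ z.2 = 0 then 0 else ⊤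

/-- Pushing forward by embeddings with a common measurable left inverse is a bijection between
the sets of couplings. -/
theorem Coupling.bijOn_map_prodMap {X Y : Type*} [MeasurableSpace X] [MeasurableSpace Y]
    {μ ν : Measure X} {f g : X → Y} {r : Y → X}
    (hf : MeasurableEmbedding f) (hg : MeasurableEmbedding g) (hr : Measurable r)
    (hrf : Function.LeftInverse r f) (hrg : Function.LeftInverse r g) :
    Set.BijOn (fun π : Measure (X × X) => π.map (Prod.map f g))
      (Coupling μ ν) (Coupling (μ.map f) (ν.map g)) := by
  have hF : Measurable (Prod.map f g) := hf.measurable.prodMap hg.measurable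
  have hR : Measurable (Prod.map r r) := hr.prodMap hr
  have hmap {ρ : Measure X} {h : X → Y} (hh : Measurable h) (hrh : Function.LeftInverse r h) :
      (ρ.map h).map r = ρ := by
    rw [Measure.map_map hr hh, hrh.comp_eq_id, Measure.map_id]
  refine ⟨?_, ?_, ?_⟩
  · rintro π ⟨hπ, rfl, rfl⟩
    refine ⟨Measure.isProbabilityMeasure_map hF.aemeasurable, ?_, ?_⟩
    · rw [Measure.map_map measurable_fst hF, Measure.map_map hf.measurable measurable_fst]
      rfl
    · rw [Measure.map_map measurable_snd hF, Measure.map_map hg.measurable measurable_snd]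
      rfl
  · refine Set.LeftInvOn.injOn (f₁' := fun γ : Measure (Y × Y) => γ.map (Prod.map r r)) ?_
    intro π _
    change (π.map (Prod.map f g)).map (Prod.map r r) = π
    rw [Measure.map_map hR hF, Prod.map_comp_map, hrf.comp_eq_id, hrg.comp_eq_id, Prod.map_id,
      Measure.map_id]
  · rintro γ ⟨hγ, h₁, h₂⟩
    refine ⟨γ.map (Prod.map r r), ⟨Measure.isProbabilityMeasure_map hR.aemeasurable, ?_, ?_⟩, ?_⟩
    · rw [Measure.map_map measurable_fst hR, Prod.map_fst', ← Measure.map_map hr measurable_fst,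
        h₁, hmap hf.measurable hrf]
    · rw [Measure.map_map measurable_snd hR, Prod.map_snd', ← Measure.map_map hr measurable_snd,
        h₂, hmap hg.measurable hrg]
    · have hfst : ∀ᵐ q ∂γ, f (r q.1) = q.1 := by
        refine ae_of_ae_map (p := fun y => f (r y) = y) measurable_fst.aemeasurable ?_
        rw [h₁, hf.ae_map_iff]
        exact .of_forall fun x => by rw [hrf x]
      have hsnd : ∀ᵐ q ∂γ, g (r q.2) = q.2 := by
        refine ae_of_ae_map (p := fun y => g (r y) = y) measurable_snd.aemeasurable ?_
        rw [h₂, hg.ae_map_iff]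
        exact .of_forall fun x => by rw [hrg x]
      change (γ.map (Prod.map r r)).map (Prod.map f g) = γ
      rw [Measure.map_map hF hR]
      conv_rhs => rw [← Measure.map_id (μ := γ)]
      refine Measure.map_congr ?_
      filter_upwards [hfst, hsnd] with q hq₁ hq₂
      exact Prod.ext hq₁ hq₂

theorem cbar_one_sub_zero {d : ℕ} (c : EuclideanSpace ℝ (Fin d) → ℝ)
    (x y : EuclideanSpace ℝ (Fin d)) :
    cbar c (((1 : ℝ), x) - ((0 : ℝ), y)) = ENNReal.ofReal (c (y - x)) := by
  simp [cbar]

/-- Equivalence of the transport problem with its space-time lifting. -/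
theorem transport_equiv_spacetime_lifting {d : ℕ}
    (c : EuclideanSpace ℝ (Fin d) → ℝ)
    (hconv : ConvexOn ℝ Set.univ c) (hnonneg : ∀ x, 0 ≤ c x)
    (μ ν : Measure (EuclideanSpace ℝ (Fin d)))
    [IsProbabilityMeasure μ] [IsProbabilityMeasure ν] :
    Set.BijOn
      (fun π : Measure (EuclideanSpace ℝ (Fin d) × EuclideanSpace ℝ (Fin d)) =>
        π.map (fun p => (((1 : ℝ), p.1), ((0 : ℝ), p.2))))
      (Coupling μ ν)
      (Coupling (μ.map (fun x => ((1 : ℝ), x))) (ν.map (fun x => ((0 : ℝ), x)))) ∧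
    (∀ π ∈ Coupling μ ν,
      ∫⁻ q, cbar c (q.1 - q.2) ∂(π.map (fun p => (((1 : ℝ), p.1), ((0 : ℝ), p.2)))) =
        ∫⁻ p, ENNReal.ofReal (c (p.2 - p.1)) ∂π) ∧
    (∀ π ∈ Coupling μ ν,
      ((∀ π' ∈ Coupling μ ν,
          ∫⁻ p, ENNReal.ofReal (c (p.2 - p.1)) ∂π ≤
            ∫⁻ p, ENNReal.ofReal (c (p.2 - p.1)) ∂π') ↔
        (∀ γ ∈ Coupling (μ.map (fun x => ((1 : ℝ), x))) (ν.map (fun x => ((0 : ℝ), x))),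
          ∫⁻ q, cbar c (q.1 - q.2)
              ∂(π.map (fun p => (((1 : ℝ), p.1), ((0 : ℝ), p.2)))) ≤
            ∫⁻ q, cbar c (q.1 - q.2) ∂γ))) := by
  have hemb (t : ℝ) : MeasurableEmbedding (fun x : EuclideanSpace ℝ (Fin d) => (t, x)) :=
    measurableEmbedding_prodMk_left t
  have hbij := Coupling.bijOn_map_prodMap (μ := μ) (ν := ν) (hemb 1) (hemb 0) measurable_snd
    (fun _ => rfl) (fun _ => rfl)
  have hcost (π : Measure (EuclideanSpace ℝ (Fin d) × EuclideanSpace ℝ (Fin d))) :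
      ∫⁻ q, cbar c (q.1 - q.2) ∂(π.map (fun p => (((1 : ℝ), p.1), ((0 : ℝ), p.2)))) =
        ∫⁻ p, ENNReal.ofReal (c (p.2 - p.1)) ∂π := by
    refine (((hemb 1).prodMap (hemb 0)).lintegral_map _).trans ?_
    exact lintegral_congr fun p => cbar_one_sub_zero c p.1 p.2
  refine ⟨hbij, fun π _ => hcost π, fun π _ => ?_⟩
  rw [← hbij.image_eq, Set.forall_mem_image, hcost]
  exact forall₂_congr fun π' _ => by rw [← hcost π']; rfl
end

section
/- Lower semicontinuity of the lifted cost. Let c : ℝ^d → ℝ be convex, nonnegative, and of superlinear growth (c(x)/|x| → ∞ as |x| → ∞). Then the associated extended cost c̄ : ℝ × ℝ^d → [0,∞] is lower semicontinuous on ℝ × ℝ^d. -/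
open MeasureTheory Classical

/-- A convex cost makes the extended cost continuous at every point with positive time. -/
theorem cbar_continuousAt_of_pos {d : ℕ} {c : EuclideanSpace ℝ (Fin d) → ℝ}
    (hconv : ConvexOn ℝ Set.univ c) {z : ℝ × EuclideanSpace ℝ (Fin d)} (hz : 0 < z.1) :
    ContinuousAt (cbar c) z := by
  have hc : Continuous c := continuousOn_univ.mp (hconv.continuousOn isOpen_univ)
  have hinv : ContinuousAt (fun p : ℝ × EuclideanSpace ℝ (Fin d) => p.1⁻¹) z :=
    continuousAt_fst.inv₀ hz.ne'
  have hcont : ContinuousAt (fun p : ℝ × EuclideanSpace ℝ (Fin d) =>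
      ENNReal.ofReal (p.1 * c (-(p.1⁻¹ • p.2)))) z :=
    ENNReal.continuous_ofReal.continuousAt.comp
      (continuousAt_fst.mul (hc.continuousAt.comp (hinv.smul continuousAt_snd).neg))
  refine hcont.congr ?_
  filter_upwards [continuousAt_fst.eventually_const_lt hz] with p hp
  simp [cbar, hp]

/-- A cost of superlinear growth makes the extended cost blow up near every point with zero time
and nonzero displacement. -/
theorem eventually_lt_cbar_of_ne_zero {d : ℕ} {c : EuclideanSpace ℝ (Fin d) → ℝ}
    (hsuper : Filter.Tendsto (fun x => c x / ‖x‖)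
      (Bornology.cobounded (EuclideanSpace ℝ (Fin d))) Filter.atTop)
    {x : EuclideanSpace ℝ (Fin d)} (hx : x ≠ 0) {y : ENNReal} (hy : y < ⊤) :
    ∀ᶠ p in nhds ((0 : ℝ), x), y < cbar c p := by
  have hx' : 0 < ‖x‖ := norm_pos_iff.mpr hx
  obtain ⟨R, -, hR⟩ := (Filter.hasBasis_cobounded_norm).eventually_iff.mp
    (hsuper.eventually_ge_atTop (2 * (y.toReal + 1) / ‖x‖))
  have hnorm : ∀ᶠ p in nhds ((0 : ℝ), x), ‖x‖ / 2 < ‖p.2‖ :=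
    continuousAt_snd.norm.eventually_const_lt (by simpa using hx')
  have hsmall : ∀ᶠ p in nhds ((0 : ℝ), x), R * p.1 < ‖x‖ / 2 :=
    (continuousAt_const.mul continuousAt_fst).eventually_lt_const (by simpa using hx')
  filter_upwards [hnorm, hsmall] with p hp hRp
  by_cases ht : 0 < p.1
  · have hp0 : 0 < ‖p.2‖ := by linarith
    have hw : ‖-(p.1⁻¹ • p.2)‖ = ‖p.2‖ / p.1 := by
      rw [norm_neg, norm_smul, norm_inv, Real.norm_of_nonneg ht.le]
      ring
    have hge := @hR (-(p.1⁻¹ • p.2)) (by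
      rw [Set.mem_ofPred_eq, hw, le_div_iff₀ ht]
      linarith)
    rw [hw, le_div_iff₀ (by positivity)] at hge
    have hlt : y.toReal < p.1 * c (-(p.1⁻¹ • p.2)) := by
      calc y.toReal < 2 * (y.toReal + 1) / ‖x‖ * (‖x‖ / 2) := by
            field_simp
            linarith
        _ ≤ 2 * (y.toReal + 1) / ‖x‖ * ‖p.2‖ := by gcongr
        _ = p.1 * (2 * (y.toReal + 1) / ‖x‖ * (‖p.2‖ / p.1)) := by field_simp
        _ ≤ p.1 * c (-(p.1⁻¹ • p.2)) := by gcongr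
    simpa [cbar, ht] using (ENNReal.lt_ofReal_iff_toReal_lt hy.ne).mpr hlt
  · have hp2 : p.2 ≠ 0 := norm_pos_iff.mp (by linarith)
    simpa [cbar, ht, hp2] using hy

/-- Lower semicontinuity of the lifted cost, for a convex nonnegative cost of
superlinear growth. -/
theorem cbar_lowerSemicontinuous {d : ℕ}
    (c : EuclideanSpace ℝ (Fin d) → ℝ)
    (hconv : ConvexOn ℝ Set.univ c) (hnonneg : ∀ x, 0 ≤ c x)
    (hsuper : Filter.Tendsto (fun x => c x / ‖x‖)
      (Bornology.cobounded (EuclideanSpace ℝ (Fin d))) Filter.atTop) :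
    LowerSemicontinuous (cbar c) := by
  rintro ⟨t, x⟩ y hy
  rcases lt_trichotomy t 0 with ht | rfl | ht
  · filter_upwards [continuousAt_fst.eventually_lt_const ht] with p hp
    simpa [cbar, hp.not_gt, hp.ne] using hy.trans_le le_top
  · rcases eq_or_ne x 0 with rfl | hx
    · simp [cbar] at hy
    · exact eventually_lt_cbar_of_ne_zero hsuper hx (hy.trans_le le_top)
  · exact (cbar_continuousAt_of_pos hconv ht).eventually_const_lt hy
end

section
/- The Lax formula produces a space-time potential. Let c : ℝ^d → ℝ be convex and nonnegative, let c̄ be the associated extended cost on ℝ × ℝ^d, let ψ : ℝ^d → ℝ be bounded, and define φ̄ on [0,∞) × ℝ^d by φ̄(z) := inf over y ∈ ℝ^d of ( −ψ(y) + c̄(z − (0,y)) ) (so that φ̄(0,x) = −ψ(x)). Then: (i) φ̄ is real-valued; (ii) φ̄(z) − φ̄(z') ≤ c̄(z − z') for all z, z' ∈ [0,∞) × ℝ^d (inequality in [−∞,∞], the right-hand side possibly ∞); (iii) if φ : ℝ^d → ℝ satisfies φ(x) = sup over y of (ψ(y) − c(y − x)) for all x, then φ̄(1,x) = −φ(x)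 for all x ∈ ℝ^d. -/
open MeasureTheory Classical

/-- The space-time potential defined by the Lax formula:
`φ̄(z) := inf_y ( −ψ(y) + c̄(z − (0,y)) )`, with values in the extended reals. -/
noncomputable def phibar {d : ℕ} (c : EuclideanSpace ℝ (Fin d) → ℝ)
    (ψ : EuclideanSpace ℝ (Fin d) → ℝ) : ℝ × EuclideanSpace ℝ (Fin d) → EReal :=
  fun z => ⨅ y : EuclideanSpace ℝ (Fin d),
    (((-ψ y : ℝ)) : EReal) + (cbar c (z - ((0 : ℝ), y)) : EReal)

/-- The perspective of a convex nonnegative function is subadditive. -/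
theorem cbar_add_le {d : ℕ} {c : EuclideanSpace ℝ (Fin d) → ℝ}
    (hconv : ConvexOn ℝ Set.univ c) (hnonneg : ∀ x, 0 ≤ c x)
    (a b : ℝ × EuclideanSpace ℝ (Fin d)) : cbar c (a + b) ≤ cbar c a + cbar c b := by
  obtain ⟨t, x⟩ := a
  obtain ⟨s, y⟩ := b
  by_cases ht : 0 < t
  · by_cases hs : 0 < s
    · have hts : 0 < t + s := add_pos ht hs
      simp only [cbar, Prod.mk_add_mk, ht, hs, hts, if_true]
      rw [← ENNReal.ofReal_add (mul_nonneg ht.le (hnonneg _)) (mul_nonneg hs.le (hnonneg _))]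
      apply ENNReal.ofReal_le_ofReal
      have h := hconv.2 (Set.mem_univ (-(t⁻¹ • x))) (Set.mem_univ (-(s⁻¹ • y)))
        (div_nonneg ht.le hts.le) (div_nonneg hs.le hts.le) (by field_simp)
      have harg : (t / (t + s)) • -(t⁻¹ • x) + (s / (t + s)) • -(s⁻¹ • y)
          = -((t + s)⁻¹ • (x + y)) := by
        have h1 : t / (t + s) * t⁻¹ = (t + s)⁻¹ := by field_simp
        have h2 : s / (t + s) * s⁻¹ = (t + s)⁻¹ := by field_simp
        rw [smul_neg, smul_neg, smul_smul, smul_smul, h1, h2, smul_add, neg_add]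
      rw [harg] at h
      calc (t + s) * c (-((t + s)⁻¹ • (x + y)))
          ≤ (t + s) * ((t / (t + s)) • c (-(t⁻¹ • x)) + (s / (t + s)) • c (-(s⁻¹ • y))) :=
            mul_le_mul_of_nonneg_left h hts.le
        _ = t * c (-(t⁻¹ • x)) + s * c (-(s⁻¹ • y)) := by
            simp only [smul_eq_mul]
            field_simp
    · by_cases h0 : s = 0 ∧ y = 0
      · obtain ⟨rfl, rfl⟩ := h0
        simp [cbar]
      · simp [cbar, hs, h0]
  · by_cases h0 : t = 0 ∧ x = 0
    · obtain ⟨rfl, rfl⟩ := h0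
      simp [cbar]
    · simp [cbar, ht, h0]

theorem cbar_zero_right_ne_top {d : ℕ} (c : EuclideanSpace ℝ (Fin d) → ℝ) {t : ℝ}
    (ht : 0 ≤ t) : cbar c (t, 0) ≠ ⊤ := by
  rcases ht.eq_or_lt with rfl | ht
  · simp [cbar]
  · simp [cbar, ht]

theorem exists_phibar_eq_coe {d : ℕ} (c ψ : EuclideanSpace ℝ (Fin d) → ℝ) {M : ℝ}
    (hψ : ∀ y, ψ y ≤ M) {z : ℝ × EuclideanSpace ℝ (Fin d)} (hz : 0 ≤ z.1) :
    ∃ r : ℝ, phibar c ψ z = (r : EReal) := by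
  have hlow : ((-M : ℝ) : EReal) ≤ phibar c ψ z := le_iInf fun y =>
    (EReal.coe_le_coe_iff.2 (neg_le_neg (hψ y))).trans
      (le_add_of_nonneg_right (EReal.coe_ennreal_nonneg _))
  have hup : phibar c ψ z < ⊤ := by
    refine (iInf_le _ z.2).trans_lt ?_
    have hz2 : z - ((0 : ℝ), z.2) = (z.1, 0) := by ext <;> simp
    rw [hz2]
    exact EReal.add_lt_top (EReal.coe_ne_top _)
      (by simpa using cbar_zero_right_ne_top c hz)
  have hbot : phibar c ψ z ≠ ⊥ := ((EReal.bot_lt_coe _).trans_le hlow).ne'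
  exact ⟨_, (EReal.coe_toReal hup.ne hbot).symm⟩

theorem phibar_le_add {d : ℕ} {c : EuclideanSpace ℝ (Fin d) → ℝ}
    (hconv : ConvexOn ℝ Set.univ c) (hnonneg : ∀ x, 0 ≤ c x)
    (ψ : EuclideanSpace ℝ (Fin d) → ℝ) (z z' : ℝ × EuclideanSpace ℝ (Fin d))
    (y : EuclideanSpace ℝ (Fin d)) :
    phibar c ψ z ≤ ((-ψ y : ℝ) : EReal) + (cbar c (z' - ((0 : ℝ), y)) : EReal)
      + (cbar c (z - z') : EReal) := by
  refine (iInf_le _ y).trans ?_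
  rw [add_assoc, ← EReal.coe_ennreal_add]
  gcongr
  have h := cbar_add_le hconv hnonneg (z' - ((0 : ℝ), y)) (z - z')
  rw [show z' - ((0 : ℝ), y) + (z - z') = z - ((0 : ℝ), y) by abel] at h
  exact EReal.coe_ennreal_le_coe_ennreal_iff.2 h

theorem phibar_one {d : ℕ} {c : EuclideanSpace ℝ (Fin d) → ℝ} (hnonneg : ∀ x, 0 ≤ c x)
    (ψ : EuclideanSpace ℝ (Fin d) → ℝ) (x : EuclideanSpace ℝ (Fin d)) :
    phibar c ψ ((1 : ℝ), x) = ⨅ y, ((-(ψ y - c (y - x)) : ℝ) : EReal) := by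
  refine iInf_congr fun y => ?_
  have h : cbar c (((1 : ℝ), x) - ((0 : ℝ), y)) = ENNReal.ofReal (c (y - x)) := by
    simp [cbar]
  rw [h, EReal.coe_ennreal_ofReal, max_eq_left (hnonneg _), ← EReal.coe_add]
  congr 1
  ring

/-- The Lax formula produces a space-time potential: it is real-valued on `[0,∞) × ℝ^d`,
it is compatible with the lifted cost, and at time `1` it coincides with `−φ`, where
`φ(x) = sup_y (ψ(y) − c(y − x))`. -/
theorem lax_formula_spacetime_potential {d : ℕ}
    (c : EuclideanSpace ℝ (Fin d) → ℝ)
    (hconv : ConvexOn ℝ Set.univ c) (hnonneg : ∀ x, 0 ≤ c x)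
    (ψ : EuclideanSpace ℝ (Fin d) → ℝ) (M : ℝ) (hψ : ∀ y, |ψ y| ≤ M) :
    (∀ z : ℝ × EuclideanSpace ℝ (Fin d), 0 ≤ z.1 →
      ∃ r : ℝ, phibar c ψ z = (r : EReal)) ∧
    (∀ z z' : ℝ × EuclideanSpace ℝ (Fin d), 0 ≤ z.1 → 0 ≤ z'.1 →
      phibar c ψ z - phibar c ψ z' ≤ (cbar c (z - z') : EReal)) ∧
    (∀ φ : EuclideanSpace ℝ (Fin d) → ℝ,
      (∀ x, IsLUB (Set.range fun y => ψ y - c (y - x)) (φ x)) →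
      ∀ x, phibar c ψ ((1 : ℝ), x) = ((-φ x : ℝ) : EReal)) := by
  have hreal : ∀ z : ℝ × EuclideanSpace ℝ (Fin d), 0 ≤ z.1 →
      ∃ r : ℝ, phibar c ψ z = (r : EReal) := fun z hz =>
    exists_phibar_eq_coe c ψ (fun y => (le_abs_self _).trans (hψ y)) hz
  refine ⟨hreal, fun z z' hz hz' => ?_, fun φ hφ x => ?_⟩
  · obtain ⟨r, hr⟩ := hreal z hz
    obtain ⟨r', hr'⟩ := hreal z' hz'
    by_cases htop : cbar c (z - z') = ⊤
    · simp [htop]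
    obtain ⟨k, hk⟩ : ∃ k : ℝ, (cbar c (z - z') : EReal) = k :=
      ⟨_, (EReal.coe_toReal (by simpa using htop) (EReal.coe_ennreal_ne_bot _)).symm⟩
    have hle : ((r - k : ℝ) : EReal) ≤ phibar c ψ z' := by
      refine le_iInf fun y => ?_
      have h := phibar_le_add hconv hnonneg ψ z z' y
      rw [hr, hk] at h
      rw [EReal.coe_sub]
      exact EReal.sub_le_of_le_add h
    rw [hr', EReal.coe_le_coe_iff] at hle
    rw [hr, hr', hk, ← EReal.coe_sub, EReal.coe_le_coe_iff]
    linarith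
  · obtain ⟨r, hr⟩ := hreal ((1 : ℝ), x) zero_le_one
    have hinf := phibar_one hnonneg ψ x
    apply le_antisymm
    · have hub : φ x ≤ -r := by
        refine (hφ x).2 ?_
        rintro _ ⟨y, rfl⟩
        have h := iInf_le (fun y => ((-(ψ y - c (y - x)) : ℝ) : EReal)) y
        rw [← hinf, hr, EReal.coe_le_coe_iff] at h
        linarith
      rw [hr, EReal.coe_le_coe_iff]
      linarith
    · rw [hinf]
      exact le_iInf fun y => EReal.coe_le_coe_iff.2 (neg_le_neg ((hφ x).1 ⟨y, rfl⟩))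
end

section
/- Minimal extreme face through a point of a compact convex set (elementary face lemma used in Lemma 4.9). Let K ⊆ ℝ^n be a compact convex set with 0 ∈ K, and set F := K ∩ span(K ∩ (−K)), where span denotes the linear span. Then F is convex, F is an extreme subset of K (if x, y ∈ K, t ∈ (0,1) and t·x + (1−t)·y ∈ F, then x, y ∈ F), and 0 belongs to the intrinsic (relative) interior of F. -/
/-- In a convex set containing `0`, if `x` and some negative multiple of `x` belong to the set,
then `x` lies in the span of the symmetric part of the set. -/
theorem Convex.mem_span_inter_neg_of_neg_smul_mem {E : Type*} [AddCommGroup E] [Module ℝ E]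
    {K : Set E} (hK : Convex ℝ K) (h0 : (0 : E) ∈ K) {x : E} (hx : x ∈ K) {s : ℝ} (hs : 0 < s)
    (hsx : -(s • x) ∈ K) : x ∈ Submodule.span ℝ (K ∩ -K) := by
  have hpos : 0 < s / (1 + s) := by positivity
  have hmem : (s / (1 + s)) • x ∈ K ∩ -K := by
    refine ⟨hK.smul_mem_of_zero_mem h0 hx ⟨hpos.le, ?_⟩, ?_⟩
    · rw [div_le_one (by positivity)]
      linarith
    · have h := hK.smul_mem_of_zero_mem h0 hsx
        (t := 1 / (1 + s)) ⟨by positivity, by rw [div_le_one (by positivity)]; linarith⟩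
      rw [Set.mem_neg]
      convert h using 1
      rw [smul_neg, smul_smul]
      congr 2
      ring
  exact (Submodule.smul_mem_iff _ hpos.ne').1 (Submodule.subset_span hmem)

/-- Every element of the span of the symmetric part of a convex set containing `0` has a positive
multiple in the symmetric part. -/
theorem Convex.exists_pos_smul_mem_inter_neg {E : Type*} [AddCommGroup E] [Module ℝ E]
    {K : Set E} (hK : Convex ℝ K) (h0 : (0 : E) ∈ K) {x : E}
    (hx : x ∈ Submodule.span ℝ (K ∩ -K)) : ∃ r : ℝ, 0 < r ∧ r • x ∈ K ∩ -K := by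
  have hS : Convex ℝ (K ∩ -K) := hK.inter hK.neg
  have hS0 : (0 : E) ∈ K ∩ -K := ⟨h0, by simpa using h0⟩
  have hSneg : ∀ y ∈ K ∩ -K, -y ∈ K ∩ -K := fun y hy => ⟨hy.2, by simpa using hy.1⟩
  induction hx using Submodule.span_induction with
  | mem x hx => exact ⟨1, one_pos, by simpa using hx⟩
  | zero => exact ⟨1, one_pos, by simpa using hS0⟩
  | add x y _ _ hx hy =>
    obtain ⟨a, ha, hax⟩ := hx
    obtain ⟨b, hb, hby⟩ := hy
    refine ⟨a * b / (a + b), by positivity, ?_⟩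
    have h := hS hax hby (a := b / (a + b)) (b := a / (a + b)) (by positivity) (by positivity)
      (by field_simp; ring)
    convert h using 1
    rw [smul_add, smul_smul, smul_smul]
    congr 2 <;> ring
  | smul c x _ hx =>
    obtain ⟨a, ha, hax⟩ := hx
    rcases lt_trichotomy c 0 with hc | rfl | hc
    · refine ⟨a / -c, div_pos ha (neg_pos.2 hc), ?_⟩
      convert hSneg _ hax using 1
      rw [smul_smul, ← neg_smul]
      congr 1
      rw [div_neg, neg_mul, div_mul_cancel₀ _ hc.ne]
    · exact ⟨1, one_pos, by simpa using hS0⟩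
    · refine ⟨a / c, div_pos ha hc, ?_⟩
      rwa [smul_smul, div_mul_cancel₀ _ hc.ne']

/-- If a convex combination of two points of a convex set `K` containing `0` with positive weight
on the first lies in the span of `K ∩ -K`, then so does the first point. -/
theorem Convex.mem_span_inter_neg_of_combo_mem {E : Type*} [AddCommGroup E] [Module ℝ E]
    {K : Set E} (hK : Convex ℝ K) (h0 : (0 : E) ∈ K) {x y : E} (hx : x ∈ K) (hy : y ∈ K)
    {a b : ℝ} (ha : 0 < a) (hb : 0 ≤ b)
    (h : a • x + b • y ∈ Submodule.span ℝ (K ∩ -K)) : x ∈ Submodule.span ℝ (K ∩ -K) := by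
  obtain ⟨r, hr, -, hz⟩ := hK.exists_pos_smul_mem_inter_neg h0 h
  refine hK.mem_span_inter_neg_of_neg_smul_mem h0 hx (s := r * a / (1 + r * b))
    (by positivity) ?_
  have hc := hK hz hy (a := 1 / (1 + r * b)) (b := r * b / (1 + r * b)) (by positivity)
    (by positivity) (by field_simp)
  convert hc using 1
  match_scalars <;> field_simp
  ring

/-- The symmetric part of a convex set containing `0` is a neighbourhood of `0` in its span. -/
theorem Convex.preimage_inter_neg_mem_nhds_zero {E : Type*} [NormedAddCommGroup E]
    [NormedSpace ℝ E] [FiniteDimensional ℝ E] {K : Set E} (hK : Convex ℝ K) (h0 : (0 : E) ∈ K) :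
    ((↑) ⁻¹' (K ∩ -K) : Set (Submodule.span ℝ (K ∩ -K))) ∈
      nhds (0 : Submodule.span ℝ (K ∩ -K)) := by
  set S : Set (Submodule.span ℝ (K ∩ -K)) := (↑) ⁻¹' (K ∩ -K) with hSdef
  have hS : Convex ℝ S :=
    (hK.inter hK.neg).linear_preimage (Submodule.span ℝ (K ∩ -K)).subtype
  have hS0 : (0 : Submodule.span ℝ (K ∩ -K)) ∈ S := ⟨h0, by simpa using h0⟩
  have hspan : affineSpan ℝ S = ⊤ := by
    apply SetLike.coe_injective
    rw [← Set.insert_eq_of_mem hS0, affineSpan_insert_zero, hSdef,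
      Submodule.span_span_coe_preimage]
    rfl
  obtain ⟨p, hp⟩ := hS.interior_nonempty_iff_affineSpan_eq_top.2 hspan
  have hpS := interior_subset hp
  have hnp : -p ∈ S := ⟨hpS.2, by simpa using hpS.1⟩
  have h : (0 : Submodule.span ℝ (K ∩ -K)) ∈ interior S := by
    apply hS.openSegment_interior_self_subset_interior hp hnp
    exact ⟨1 / 2, 1 / 2, by norm_num, by norm_num, by norm_num, by simp⟩
  exact mem_interior_iff_mem_nhds.1 h


/-- Minimal extreme face through a point of a compact convex set: if `K` is compact convex
with `0 ∈ K` and `F := K ∩ span(K ∩ (−K))`, then `F` is convex, `F` is an extreme subset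
of `K`, and `0` lies in the intrinsic (relative) interior of `F`. -/
theorem minimal_extreme_face_of_compact_convex {n : ℕ}
    (K : Set (EuclideanSpace ℝ (Fin n))) (hKc : IsCompact K) (hKconv : Convex ℝ K)
    (h0 : (0 : EuclideanSpace ℝ (Fin n)) ∈ K) :
    Convex ℝ (K ∩ (Submodule.span ℝ (K ∩ (-K)) : Set (EuclideanSpace ℝ (Fin n)))) ∧
    (∀ x ∈ K, ∀ y ∈ K, ∀ t : ℝ, t ∈ Set.Ioo (0 : ℝ) 1 →
      t • x + (1 - t) • y ∈
          K ∩ (Submodule.span ℝ (K ∩ (-K)) : Set (EuclideanSpace ℝ (Fin n))) →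
      x ∈ K ∩ (Submodule.span ℝ (K ∩ (-K)) : Set (EuclideanSpace ℝ (Fin n))) ∧
        y ∈ K ∩ (Submodule.span ℝ (K ∩ (-K)) : Set (EuclideanSpace ℝ (Fin n)))) ∧
    (0 : EuclideanSpace ℝ (Fin n)) ∈
      intrinsicInterior ℝ
        (K ∩ (Submodule.span ℝ (K ∩ (-K)) : Set (EuclideanSpace ℝ (Fin n)))) := by
  refine ⟨hKconv.inter (Submodule.convex _), ?_, ?_⟩
  · rintro x hx y hy t ⟨ht0, ht1⟩ ⟨-, hz⟩
    have ht : 0 < 1 - t := sub_pos.2 ht1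
    refine ⟨⟨hx, hKconv.mem_span_inter_neg_of_combo_mem h0 hx hy ht0 ht.le hz⟩, hy, ?_⟩
    rw [add_comm] at hz
    exact hKconv.mem_span_inter_neg_of_combo_mem h0 hy hx ht ht0.le hz
  · set V := Submodule.span ℝ (K ∩ (-K))
    have hle : affineSpan ℝ (K ∩ (V : Set (EuclideanSpace ℝ (Fin n)))) ≤ V.toAffineSubspace :=
      affineSpan_le.2 Set.inter_subset_right
    have h0F : (0 : EuclideanSpace ℝ (Fin n)) ∈
        affineSpan ℝ (K ∩ (V : Set (EuclideanSpace ℝ (Fin n)))) :=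
      subset_affineSpan ℝ _ ⟨h0, V.zero_mem⟩
    obtain ⟨ε, hε, hball⟩ := Metric.mem_nhds_iff.1 (hKconv.preimage_inter_neg_mem_nhds_zero h0)
    refine mem_intrinsicInterior.2 ⟨⟨0, h0F⟩, ?_, rfl⟩
    refine mem_interior_iff_mem_nhds.2 (Metric.mem_nhds_iff.2 ⟨ε, hε, fun y hy => ?_⟩)
    have hyV : (y : EuclideanSpace ℝ (Fin n)) ∈ V := hle y.2
    have hyK : (⟨y, hyV⟩ : V) ∈ Metric.ball (0 : V) ε := hy
    exact ⟨(hball hyK).1, hyV⟩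
end

section
/- Minimal extreme face of a convex cone through one of its points (Lemma 4.9, second part / Lemma 8.2, second part). Let C ⊆ ℝ^n be a closed convex cone (convex, closed, and closed under multiplication by nonnegative scalars) and let v ∈ C. Set F := {λ·w : λ ≥ 0, w ∈ C, v − w ∈ C} = ℝ≥0 · (C ∩ (v − C)). Then F is a convex cone, F is an extreme subset of C (if x, y ∈ C, t ∈ (0,1) and t·x + (1−t)·y ∈ F, then x, y ∈ F), and v belongs to the intrinsic (relative) interior of F. -/
section MinimalFace

variable {E : Type*} [AddCommGroup E] [Module ℝ E] {C : Set E} {v : E}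

theorem Convex.add_mem_of_smul_mem (hconv : Convex ℝ C)
    (hcone : ∀ r : ℝ, 0 ≤ r → ∀ c ∈ C, r • c ∈ C) {x y : E} (hx : x ∈ C) (hy : y ∈ C) :
    x + y ∈ C := by
  have h := hconv (hcone 2 zero_le_two x hx) (hcone 2 zero_le_two y hy)
    (by norm_num : (0 : ℝ) ≤ 1 / 2) (by norm_num : (0 : ℝ) ≤ 1 / 2) (by norm_num)
  simpa [smul_smul] using h

/-- The face `ℝ≥0 · (C ∩ (v - C))` consists of the points of `C` that are dominated, in the
order given by the cone `C`, by a positive multiple of `v`. -/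
theorem setOf_smul_inter_sub_eq (hconv : Convex ℝ C)
    (hcone : ∀ r : ℝ, 0 ≤ r → ∀ c ∈ C, r • c ∈ C) (hv : v ∈ C) :
    {x | ∃ r : ℝ, 0 ≤ r ∧ ∃ w ∈ C, v - w ∈ C ∧ x = r • w} =
      {x | x ∈ C ∧ ∃ s : ℝ, 0 < s ∧ s • v - x ∈ C} := by
  ext x
  constructor
  · rintro ⟨r, hr, w, hw, hvw, rfl⟩
    refine ⟨hcone r hr w hw, r + 1, by positivity, ?_⟩
    convert hconv.add_mem_of_smul_mem hcone (hcone r hr _ hvw) hv using 1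
    module
  · rintro ⟨hx, s, hs, hsx⟩
    refine ⟨s, hs.le, s⁻¹ • x, hcone _ (by positivity) x hx, ?_, ?_⟩
    · simpa [smul_sub, smul_smul, hs.ne'] using hcone s⁻¹ (by positivity) _ hsx
    · simp [smul_smul, hs.ne']

theorem convex_setOf_mem_and_smul_sub_mem (hconv : Convex ℝ C)
    (hcone : ∀ r : ℝ, 0 ≤ r → ∀ c ∈ C, r • c ∈ C) (hv : v ∈ C) :
    Convex ℝ {x | x ∈ C ∧ ∃ s : ℝ, 0 < s ∧ s • v - x ∈ C} := by
  rintro x ⟨hx, s, hs, hsx⟩ y ⟨hy, t, ht, hty⟩ a b ha hb hab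
  refine ⟨hconv hx hy ha hb hab, a * s + b * t + 1, by positivity, ?_⟩
  convert hconv.add_mem_of_smul_mem hcone (hconv hsx hty ha hb hab) hv using 1
  module

theorem smul_mem_setOf_mem_and_smul_sub_mem (hconv : Convex ℝ C)
    (hcone : ∀ r : ℝ, 0 ≤ r → ∀ c ∈ C, r • c ∈ C) (hv : v ∈ C) {r : ℝ} (hr : 0 ≤ r) {x : E}
    (hx : x ∈ {x | x ∈ C ∧ ∃ s : ℝ, 0 < s ∧ s • v - x ∈ C}) :
    r • x ∈ {x | x ∈ C ∧ ∃ s : ℝ, 0 < s ∧ s • v - x ∈ C} := by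
  obtain ⟨hx, s, hs, hsx⟩ := hx
  refine ⟨hcone r hr x hx, r * s + 1, by positivity, ?_⟩
  convert hconv.add_mem_of_smul_mem hcone (hcone r hr _ hsx) hv using 1
  module

theorem mem_of_smul_add_mem_setOf_mem_and_smul_sub_mem (hconv : Convex ℝ C)
    (hcone : ∀ r : ℝ, 0 ≤ r → ∀ c ∈ C, r • c ∈ C) {x y : E} (hx : x ∈ C) (hy : y ∈ C)
    {a b : ℝ} (ha : 0 < a) (hb : 0 ≤ b)
    (h : a • x + b • y ∈ {x | x ∈ C ∧ ∃ s : ℝ, 0 < s ∧ s • v - x ∈ C}) :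
    x ∈ {x | x ∈ C ∧ ∃ s : ℝ, 0 < s ∧ s • v - x ∈ C} := by
  obtain ⟨-, s, hs, hsz⟩ := h
  refine ⟨hx, a⁻¹ * s, by positivity, ?_⟩
  convert hcone a⁻¹ (by positivity) _
    (hconv.add_mem_of_smul_mem hcone hsz (hcone b hb y hy)) using 1
  match_scalars <;> field_simp
  ring

end MinimalFace

/-- If a positive multiple of `v` is the sum of a point of a convex cone `F` and a relative
interior point of `F`, then `v` is a relative interior point of `F`. -/
theorem Convex.mem_intrinsicInterior_of_smul_sub_mem {E : Type*} [NormedAddCommGroup E]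
    [NormedSpace ℝ E] {F : Set E} {u v : E} (hconv : Convex ℝ F)
    (hcone : ∀ r : ℝ, 0 ≤ r → ∀ c ∈ F, r • c ∈ F) (hu : u ∈ intrinsicInterior ℝ F)
    (hv : v ∈ F) {s : ℝ} (hs : 0 < s) (hsu : s • v - u ∈ F) : v ∈ intrinsicInterior ℝ F := by
  obtain ⟨u, hu, rfl⟩ := mem_intrinsicInterior.1 hu
  have hvA : v ∈ affineSpan ℝ F := subset_affineSpan ℝ F hv
  let g : affineSpan ℝ F → affineSpan ℝ F := fun y =>
    ⟨s • ((y : E) - v) + u, (affineSpan ℝ F).smul_vsub_vadd_mem s y.2 hvA u.2⟩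
  have hg : Continuous g := by fun_prop
  refine mem_intrinsicInterior.2 ⟨⟨v, hvA⟩, ?_, rfl⟩
  refine interior_maximal ?_ (isOpen_interior.preimage hg)
    (show g ⟨v, hvA⟩ ∈ interior (((↑) : affineSpan ℝ F → E) ⁻¹' F) by simpa [g] using hu)
  intro y hy
  have hgy : s • ((y : E) - v) + u ∈ F :=
    interior_subset (s := ((↑) : affineSpan ℝ F → E) ⁻¹' F) hy
  have h := hcone s⁻¹ (by positivity) _ (hconv.add_mem_of_smul_mem hcone hgy hsu)
  have hy_eq : s⁻¹ • (s • ((y : E) - v) + u + (s • v - u)) = y := by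
    match_scalars <;> field_simp <;> ring
  rwa [hy_eq] at h

/-- Minimal extreme face of a closed convex cone through one of its points: for `v ∈ C`,
the set `F := ℝ≥0 · (C ∩ (v − C))` is a convex cone, an extreme subset of `C`,
and `v` lies in the intrinsic (relative) interior of `F`. -/
theorem minimal_extreme_face_of_cone {n : ℕ}
    (C : Set (EuclideanSpace ℝ (Fin n)))
    (hconv : Convex ℝ C) (hclosed : IsClosed C)
    (hcone : ∀ r : ℝ, 0 ≤ r → ∀ c ∈ C, r • c ∈ C)
    (v : EuclideanSpace ℝ (Fin n)) (hv : v ∈ C) :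
    Convex ℝ {x | ∃ r : ℝ, 0 ≤ r ∧ ∃ w ∈ C, v - w ∈ C ∧ x = r • w} ∧
    (∀ r : ℝ, 0 ≤ r → ∀ x ∈ {x | ∃ r : ℝ, 0 ≤ r ∧ ∃ w ∈ C, v - w ∈ C ∧ x = r • w},
      r • x ∈ {x | ∃ r : ℝ, 0 ≤ r ∧ ∃ w ∈ C, v - w ∈ C ∧ x = r • w}) ∧
    (∀ x ∈ C, ∀ y ∈ C, ∀ t : ℝ, t ∈ Set.Ioo (0 : ℝ) 1 →
      t • x + (1 - t) • y ∈ {x | ∃ r : ℝ, 0 ≤ r ∧ ∃ w ∈ C, v - w ∈ C ∧ x = r • w} →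
      x ∈ {x | ∃ r : ℝ, 0 ≤ r ∧ ∃ w ∈ C, v - w ∈ C ∧ x = r • w} ∧
        y ∈ {x | ∃ r : ℝ, 0 ≤ r ∧ ∃ w ∈ C, v - w ∈ C ∧ x = r • w}) ∧
    v ∈ intrinsicInterior ℝ {x | ∃ r : ℝ, 0 ≤ r ∧ ∃ w ∈ C, v - w ∈ C ∧ x = r • w} := by
  rw [setOf_smul_inter_sub_eq hconv hcone hv]
  have hF := convex_setOf_mem_and_smul_sub_mem hconv hcone hv
  have hFcone := fun (r : ℝ) (hr : 0 ≤ r) x =>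
    smul_mem_setOf_mem_and_smul_sub_mem (x := x) hconv hcone hv hr
  refine ⟨hF, hFcone, fun x hx y hy t ht h => ⟨?_, ?_⟩, ?_⟩
  · exact mem_of_smul_add_mem_setOf_mem_and_smul_sub_mem hconv hcone hx hy ht.1
      (sub_pos.2 ht.2).le h
  · rw [add_comm] at h
    exact mem_of_smul_add_mem_setOf_mem_and_smul_sub_mem hconv hcone hy hx (sub_pos.2 ht.2)
      ht.1.le h
  · have hvF : v ∈ {x | x ∈ C ∧ ∃ s : ℝ, 0 < s ∧ s • v - x ∈ C} :=
      ⟨hv, 2, two_pos, by simpa [two_smul] using hv⟩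
    obtain ⟨u, hu⟩ := Set.Nonempty.intrinsicInterior hF ⟨v, hvF⟩
    obtain ⟨huC, s, hs, hsu⟩ := intrinsicInterior_subset hu
    exact hF.mem_intrinsicInterior_of_smul_sub_mem hFcone hu hvF hs
      ⟨hsu, s, hs, by simpa using huC⟩
end

section
/- Interior of a union of translated cones (first part of Lemma 7.3). Let C ⊆ ℝ^n be a convex cone (convex and closed under multiplication by nonnegative scalars) with nonempty interior, and let A ⊆ ℝ^n be any set. Then interior(A + C) = A + interior(C), and there exists a countable subset A₀ ⊆ A such that A + interior(C) = A₀ + interior(C); in particular interior(A + C) is the union of countably many translates a + interior(C) with a ∈ A. -/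
open Pointwise

section ConvexCone

variable {E : Type*} [AddCommGroup E] [Module ℝ E] {C : Set E}

/-- A convex set closed under multiplication by nonnegative scalars is closed under addition. -/
theorem add_mem_of_convex_of_smul_mem (hconv : Convex ℝ C)
    (hcone : ∀ r : ℝ, 0 ≤ r → ∀ c ∈ C, r • c ∈ C) {c d : E} (hc : c ∈ C) (hd : d ∈ C) :
    c + d ∈ C := by
  have h := hcone 2 (by norm_num) _
    (hconv hc hd (a := 1 / 2) (b := 1 / 2) (by norm_num) (by norm_num) (by norm_num))
  simpa [smul_add, smul_smul] using h

variable [TopologicalSpace E]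

/-- The interior of a convex cone absorbs the addition of elements of the cone. -/
theorem add_mem_interior_of_convex_of_smul_mem [ContinuousAdd E] (hconv : Convex ℝ C)
    (hcone : ∀ r : ℝ, 0 ≤ r → ∀ c ∈ C, r • c ∈ C) {c d : E} (hc : c ∈ C)
    (hd : d ∈ interior C) : c + d ∈ interior C := by
  have hsub : C + interior C ⊆ interior C := by
    refine interior_maximal ?_ isOpen_interior.add_left
    rintro _ ⟨a, ha, b, hb, rfl⟩
    exact add_mem_of_convex_of_smul_mem hconv hcone ha (interior_subset hb)
  exact hsub (Set.add_mem_add hc hd)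

/-- The interior of a cone is closed under multiplication by positive scalars. -/
theorem smul_mem_interior_of_smul_mem [ContinuousConstSMul ℝ E]
    (hcone : ∀ r : ℝ, 0 ≤ r → ∀ c ∈ C, r • c ∈ C) {t : ℝ} (ht : 0 < t) {e : E}
    (he : e ∈ interior C) : t • e ∈ interior C := by
  have hsub : t • interior C ⊆ interior C := by
    refine interior_maximal ?_ (isOpen_interior.smul₀ ht.ne')
    rintro _ ⟨a, ha, rfl⟩
    exact hcone t ht.le a (interior_subset ha)
  exact hsub (Set.smul_mem_smul_set he)

theorem interior_add_subset_add_interior [IsTopologicalAddGroup E] [ContinuousSMul ℝ E]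
    (A : Set E) (hconv : Convex ℝ C) (hcone : ∀ r : ℝ, 0 ≤ r → ∀ c ∈ C, r • c ∈ C)
    (hint : (interior C).Nonempty) : interior (A + C) ⊆ A + interior C := by
  intro x hx
  obtain ⟨e, he⟩ := hint
  have hcont : Continuous fun t : ℝ ↦ x - t • e := by fun_prop
  have hnear : ∀ᶠ t in nhdsWithin (0 : ℝ) (Set.Ioi 0), x - t • e ∈ interior (A + C) :=
    (hcont.continuousAt.eventually_mem
      (isOpen_interior.mem_nhds (by simpa using hx))).filter_mono nhdsWithin_le_nhds
  obtain ⟨t, hmem, ht⟩ := (hnear.and self_mem_nhdsWithin).exists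
  obtain ⟨a, ha, c, hc, hac⟩ := interior_subset hmem
  refine ⟨a, ha, c + t • e, add_mem_interior_of_convex_of_smul_mem hconv hcone hc
    (smul_mem_interior_of_smul_mem hcone ht he), ?_⟩
  simp only at hac ⊢
  rw [← add_assoc, hac, sub_add_cancel]

end ConvexCone

/-- In a second-countable group, a union of translates of an open set is a union of countably
many of them. -/
theorem exists_countable_add_eq_add_of_isOpen {E : Type*} [AddGroup E] [TopologicalSpace E]
    [ContinuousAdd E] [SecondCountableTopology E] (A : Set E) {U : Set E} (hU : IsOpen U) :
    ∃ A₀ ⊆ A, A₀.Countable ∧ A + U = A₀ + U := by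
  obtain ⟨T, hTA, hT, hunion⟩ := TopologicalSpace.isOpen_biUnion_countable A
    (fun a ↦ a +ᵥ U) fun a _ ↦ hU.vadd a
  refine ⟨T, hTA, hT, ?_⟩
  simpa only [Set.iUnion_vadd_set, vadd_eq_add] using hunion.symm

/-- Interior of a union of translated cones: for a convex cone `C` with nonempty interior
and any set `A`, `interior(A + C) = A + interior(C)`, and this set is a union of countably
many translates of `interior(C)` by elements of `A`. -/
theorem interior_add_cone {n : ℕ}
    (C A : Set (EuclideanSpace ℝ (Fin n)))
    (hconv : Convex ℝ C)
    (hcone : ∀ r : ℝ, 0 ≤ r → ∀ c ∈ C, r • c ∈ C)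
    (hint : (interior C).Nonempty) :
    interior (A + C) = A + interior C ∧
    ∃ A₀ ⊆ A, A₀.Countable ∧ A + interior C = A₀ + interior C :=
  ⟨(interior_add_subset_add_interior A hconv hcone hint).antisymm subset_interior_add_right,
    exists_countable_add_eq_add_of_isOpen A isOpen_interior⟩
end

section
/- The upper semicontinuous envelope of a cone-monotone function is cone-monotone, and optimal rays of the function are optimal rays of its envelope at coincidence points (Lemma 9.2). Let C ⊆ ℝ^n be a convex cone, let θ : ℝ^n → ℝ be bounded and satisfy θ(w + c) ≥ θ(w) for all w ∈ ℝ^n, c ∈ C, and define its upper semicontinuous envelope ϑ(w) := inf over ε > 0 of ( sup over w' with |w' − w| < ε of θ(w') ). Then: (i) θ(w) ≤ ϑ(w) for all w; (ii) ϑ(w + c) ≥ ϑ(w) for all w ∈ ℝ^n and c ∈ C; (iii) if z ∈ ℝ^n satisfies ϑ(z) = θ(z), and z' ∈ z − C satisfies θ(z') = θ(z), then ϑ(z') = ϑ(z). -/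
/-- The upper semicontinuous envelope
`ϑ(w) = inf_{ε > 0} sup_{|w' − w| < ε} θ(w')` of a function `θ`. -/
noncomputable def uscEnv {n : ℕ} (θ : EuclideanSpace ℝ (Fin n) → ℝ) :
    EuclideanSpace ℝ (Fin n) → ℝ :=
  fun w => ⨅ ε : Set.Ioi (0 : ℝ),
    ⨆ w' : Metric.ball w (ε : ℝ), θ (w' : EuclideanSpace ℝ (Fin n))

theorem bddAbove_range_ball {n : ℕ} {θ : EuclideanSpace ℝ (Fin n) → ℝ} {M : ℝ}
    (hbdd : ∀ w, |θ w| ≤ M) (w : EuclideanSpace ℝ (Fin n)) (ε : ℝ) :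
    BddAbove (Set.range fun w' : Metric.ball w ε => θ w') :=
  ⟨M, by rintro _ ⟨w', rfl⟩; exact (abs_le.mp (hbdd _)).2⟩

theorem le_iSup_ball {n : ℕ} {θ : EuclideanSpace ℝ (Fin n) → ℝ} {M : ℝ}
    (hbdd : ∀ w, |θ w| ≤ M) (w : EuclideanSpace ℝ (Fin n)) {ε : ℝ} (hε : 0 < ε) :
    θ w ≤ ⨆ w' : Metric.ball w ε, θ (w' : EuclideanSpace ℝ (Fin n)) :=
  le_ciSup (bddAbove_range_ball hbdd w ε) ⟨w, Metric.mem_ball_self hε⟩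

theorem le_uscEnv {n : ℕ} {θ : EuclideanSpace ℝ (Fin n) → ℝ} {M : ℝ}
    (hbdd : ∀ w, |θ w| ≤ M) (w : EuclideanSpace ℝ (Fin n)) : θ w ≤ uscEnv θ w :=
  have : Nonempty (Set.Ioi (0 : ℝ)) := ⟨⟨1, Set.mem_Ioi.mpr one_pos⟩⟩
  le_ciInf fun ε => le_iSup_ball hbdd w ε.2

theorem uscEnv_le_uscEnv_add {n : ℕ} {θ : EuclideanSpace ℝ (Fin n) → ℝ} {M : ℝ}
    (hbdd : ∀ w, |θ w| ≤ M) {c : EuclideanSpace ℝ (Fin n)} (hc : ∀ w, θ w ≤ θ (w + c))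
    (w : EuclideanSpace ℝ (Fin n)) : uscEnv θ w ≤ uscEnv θ (w + c) := by
  refine ciInf_mono ⟨θ w, ?_⟩ fun ε => ?_
  · rintro _ ⟨ε, rfl⟩
    exact le_iSup_ball hbdd w ε.2
  · have : Nonempty (Metric.ball w (ε : ℝ)) := ⟨⟨w, Metric.mem_ball_self ε.2⟩⟩
    refine ciSup_le fun w' => (hc w').trans ?_
    have hmem : (w' : EuclideanSpace ℝ (Fin n)) + c ∈ Metric.ball (w + c) (ε : ℝ) := by
      rw [Metric.mem_ball, dist_add_right]
      exact w'.2
    exact le_ciSup (bddAbove_range_ball hbdd (w + c) ε) ⟨w' + c, hmem⟩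

/-- The upper semicontinuous envelope of a cone-monotone function is cone-monotone, and
optimal rays of the function are optimal rays of its envelope at coincidence points. -/
theorem uscEnv_cone_monotone_and_rays {n : ℕ}
    (C : Set (EuclideanSpace ℝ (Fin n)))
    (hconv : Convex ℝ C)
    (hcone : ∀ r : ℝ, 0 ≤ r → ∀ c ∈ C, r • c ∈ C)
    (θ : EuclideanSpace ℝ (Fin n) → ℝ) (M : ℝ) (hbdd : ∀ w, |θ w| ≤ M)
    (hmono : ∀ w, ∀ c ∈ C, θ w ≤ θ (w + c)) :
    (∀ w, θ w ≤ uscEnv θ w) ∧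
    (∀ w, ∀ c ∈ C, uscEnv θ w ≤ uscEnv θ (w + c)) ∧
    (∀ z z', uscEnv θ z = θ z → z - z' ∈ C → θ z' = θ z → uscEnv θ z' = uscEnv θ z) := by
  refine ⟨le_uscEnv hbdd, fun w c hc => uscEnv_le_uscEnv_add hbdd (fun v => hmono v c hc) w,
    fun z z' hz hC hθ => le_antisymm ?_ ?_⟩
  · simpa using uscEnv_le_uscEnv_add hbdd (fun v => hmono v _ hC) z'
  · rw [hz, ← hθ]
    exact le_uscEnv hbdd z'
end

section
/- Lax formula with attained maximum for the upper semicontinuous envelope (abstraction of Lemma 9.1). Let co : ℝ^h → ℝ be convex, positively 1-homogeneous, and such that co(v) > 0 for every v ≠ 0. Let ϑ : [0,∞) × ℝ^h → ℝ be bounded, upper semicontinuous, and satisfy ϑ(t,x) = sup { ϑ(0,y) : y ∈ ℝ^h, co(x − y) ≤ t } for every t ≥ 0 and x ∈ ℝ^h. Then for every t ≥ s ≥ 0 and every x ∈ ℝ^h, the value ϑ(t,x) equals the maximum of ϑ(s,y) over the (nonempty compact) set {y ∈ ℝ^h : co(x − y) ≤ t − s}; in particular there exists y with co(x − y) ≤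 t − s and ϑ(t,x) = ϑ(s,y). -/
/-- A continuous positively 1-homogeneous function on a finite-dimensional space which is positive
away from the origin has compact sublevel sets. -/
theorem isCompact_sublevel_of_posHomogeneous {E : Type*} [NormedAddCommGroup E] [NormedSpace ℝ E]
    [FiniteDimensional ℝ E] {co : E → ℝ} (hcont : Continuous co)
    (hhom : ∀ r : ℝ, 0 ≤ r → ∀ v, co (r • v) = r * co v)
    (hpos : ∀ v, v ≠ 0 → 0 < co v) (r : ℝ) : IsCompact {v | co v ≤ r} := by
  have : ProperSpace E := FiniteDimensional.proper ℝ E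
  refine Metric.isCompact_of_isClosed_isBounded (isClosed_le hcont continuous_const) ?_
  obtain ⟨m, hm, hle⟩ : ∃ m : ℝ, 0 < m ∧ ∀ u ∈ Metric.sphere (0 : E) 1, m ≤ co u := by
    rcases (Metric.sphere (0 : E) 1).eq_empty_or_nonempty with he | hne
    · exact ⟨1, one_pos, by simp [he]⟩
    · obtain ⟨u, hu, hmin⟩ := (isCompact_sphere (0 : E) 1).exists_isMinOn hne hcont.continuousOn
      exact ⟨co u, hpos u (ne_zero_of_mem_unit_sphere ⟨u, hu⟩), fun w hw => hmin hw⟩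
  refine (Metric.isBounded_closedBall (x := (0 : E)) (r := max 0 (r / m))).subset fun v hv => ?_
  rw [mem_closedBall_zero_iff]
  rcases eq_or_ne v 0 with rfl | hv0
  · simp
  · refine le_max_of_le_right ((le_div_iff₀ hm).2 ?_)
    have hn : 0 < ‖v‖ := norm_pos_iff.2 hv0
    have hu := hle (‖v‖⁻¹ • v) (by simp [norm_smul, hn.ne'])
    calc ‖v‖ * m ≤ ‖v‖ * co (‖v‖⁻¹ • v) := by gcongr
      _ = co v := by rw [hhom _ (by positivity), mul_inv_cancel_left₀ hn.ne']
      _ ≤ r := hv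

/-- A convex positively 1-homogeneous function is subadditive. -/
theorem ConvexOn.map_add_le_of_posHomogeneous {E : Type*} [AddCommGroup E] [Module ℝ E]
    {co : E → ℝ} (hconv : ConvexOn ℝ Set.univ co)
    (hhom : ∀ r : ℝ, 0 ≤ r → ∀ v, co (r • v) = r * co v) (v w : E) :
    co (v + w) ≤ co v + co w := by
  have key := hconv.2 (Set.mem_univ v) (Set.mem_univ w)
    (by norm_num : (0 : ℝ) ≤ 1 / 2) (by norm_num : (0 : ℝ) ≤ 1 / 2) (by norm_num)
  rw [← smul_add, hhom _ (by norm_num), smul_eq_mul, smul_eq_mul] at key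
  linarith

/-- Lax formula with attained maximum for the upper semicontinuous envelope: if `ϑ` is
bounded, upper semicontinuous on `[0,∞) × ℝ^h` and satisfies the Lax formula
`ϑ(t,x) = sup {ϑ(0,y) : co(x − y) ≤ t}`, then for `t ≥ s ≥ 0` the value `ϑ(t,x)` is the
attained maximum of `ϑ(s,y)` over `{y : co(x − y) ≤ t − s}`. -/
theorem lax_formula_attained_maximum {h : ℕ}
    (co : EuclideanSpace ℝ (Fin h) → ℝ)
    (hconv : ConvexOn ℝ Set.univ co)
    (hhom : ∀ r : ℝ, 0 ≤ r → ∀ v, co (r • v) = r * co v)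
    (hpos : ∀ v, v ≠ 0 → 0 < co v)
    (ϑ : ℝ × EuclideanSpace ℝ (Fin h) → ℝ)
    (M : ℝ) (hbdd : ∀ z, |ϑ z| ≤ M)
    (husc : UpperSemicontinuousOn ϑ {z | 0 ≤ z.1})
    (hlax : ∀ t : ℝ, 0 ≤ t → ∀ x,
      ϑ (t, x) = ⨆ y : {y : EuclideanSpace ℝ (Fin h) | co (x - y) ≤ t},
        ϑ (0, (y : EuclideanSpace ℝ (Fin h)))) :
    ∀ t s : ℝ, 0 ≤ s → s ≤ t → ∀ x,
      (∃ y, co (x - y) ≤ t - s ∧ ϑ (t, x) = ϑ (s, y)) ∧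
      (∀ y, co (x - y) ≤ t - s → ϑ (s, y) ≤ ϑ (t, x)) := by
  have hcont : Continuous co :=
    continuousOn_univ.1 (hconv.continuousOn isOpen_univ)
  have hco0 : co 0 = 0 := by simpa using hhom 0 le_rfl 0
  have hle_of : ∀ t : ℝ, 0 ≤ t → ∀ x y, co (x - y) ≤ t → ϑ (0, y) ≤ ϑ (t, x) := by
    intro t ht x y hy
    rw [hlax t ht x]
    exact le_ciSup
      (f := fun y : {y : EuclideanSpace ℝ (Fin h) | co (x - y) ≤ t} => ϑ (0, y.1))
      ⟨M, by rintro _ ⟨z, rfl⟩; exact (abs_le.1 (hbdd _)).2⟩ ⟨y, hy⟩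
  have hupper : ∀ t s : ℝ, 0 ≤ s → s ≤ t → ∀ x y, co (x - y) ≤ t - s → ϑ (s, y) ≤ ϑ (t, x) := by
    intro t s hs hst x y hy
    rw [hlax s hs y]
    have : Nonempty {z : EuclideanSpace ℝ (Fin h) | co (y - z) ≤ s} := ⟨⟨y, by simp [hco0, hs]⟩⟩
    refine ciSup_le fun ⟨z, hz⟩ => hle_of t (hs.trans hst) x z ?_
    have hadd := hconv.map_add_le_of_posHomogeneous hhom (x - y) (y - z)
    rw [sub_add_sub_cancel] at hadd
    have hz' : co (y - z) ≤ s := hz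
    linarith
  intro t s hs hst x
  refine ⟨?_, hupper t s hs hst x⟩
  have ht : 0 ≤ t := hs.trans hst
  obtain ⟨z, hz, hzmax⟩ : ∃ z, co (x - z) ≤ t ∧ ϑ (t, x) ≤ ϑ (0, z) := by
    have hK : IsCompact {y | co (x - y) ≤ t} := by
      have himg := (isCompact_sublevel_of_posHomogeneous hcont hhom hpos t).image
        (continuous_const.sub continuous_id : Continuous fun v => x - v)
      convert himg using 1
      ext y
      exact ⟨fun hy => ⟨x - y, hy, sub_sub_cancel x y⟩, by
        rintro ⟨v, hv, rfl⟩; simpa using hv⟩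
    have hne : {y | co (x - y) ≤ t}.Nonempty := ⟨x, by simp [hco0, ht]⟩
    have husc0 : UpperSemicontinuousOn (fun y => ϑ (0, y)) {y | co (x - y) ≤ t} :=
      husc.comp (g := fun y => ((0 : ℝ), y)) (by fun_prop) fun y _ => le_refl (0 : ℝ)
    obtain ⟨z, hz, hmax⟩ := husc0.exists_isMaxOn hne hK
    have : Nonempty {y | co (x - y) ≤ t} := hne.to_subtype
    refine ⟨z, hz, ?_⟩
    rw [hlax t ht x]
    exact ciSup_le fun y => hmax y.2
  rcases ht.eq_or_lt with rfl | htpos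
  · obtain rfl : s = 0 := le_antisymm hst hs
    exact ⟨x, by simp [hco0], rfl⟩
  have hxy : co (x - (x - ((t - s) / t) • (x - z))) ≤ t - s := by
    have h0 : 0 ≤ (t - s) / t := div_nonneg (sub_nonneg.2 hst) ht
    rw [sub_sub_cancel, hhom _ h0]
    calc (t - s) / t * co (x - z) ≤ (t - s) / t * t := by gcongr
      _ = t - s := div_mul_cancel₀ _ htpos.ne'
  have hyz : co (x - ((t - s) / t) • (x - z) - z) ≤ s := by
    have heq : x - ((t - s) / t) • (x - z) - z = (s / t) • (x - z) := by
      rw [sub_div, div_self htpos.ne']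
      module
    rw [heq, hhom _ (by positivity)]
    calc s / t * co (x - z) ≤ s / t * t := by gcongr
      _ = s := div_mul_cancel₀ _ htpos.ne'
  exact ⟨_, hxy, le_antisymm (hzmax.trans (hle_of s hs _ z hyz)) (hupper t s hs hst x _ hxy)⟩
end
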